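/- arXiv:math/0612269 — 5 statements merged into one kernel-verified Lean document; each statement's English description precedes it below -/
import Mathlib

section
/- For every integer n ≥ 1 and every real number m ≥ 0, the iterated integral ∫_{[0,1]^n} x_1 ⋯ x_n · (1 − (x_1 + ⋯ + x_n)/n)^m dx_1 ⋯ dx_n is at least 1/((⌈m⌉+1)^n · (⌈m⌉+2)^n), where ⌈m⌉ denotes the least integer ≥ m. -/
open MeasureTheory

/-- The Beta integral `B(2, k + 1)`. -/
lemma integral_Icc_mul_one_sub_pow (k : ℕ) :
    ∫ x in Set.Icc (0 : ℝ) 1, x * (1 - x) ^ k = 1 / (((k : ℝ) + 1) * (k + 2)) := by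
  rw [integral_Icc_eq_integral_Ioc, ← intervalIntegral.integral_of_le zero_le_one]
  have h := intervalIntegral.integral_comp_sub_left (a := 0) (b := 1)
    (fun x : ℝ => (1 - x) * x ^ k) 1
  simp only [sub_sub_cancel, sub_self, sub_zero] at h
  rw [h]
  have h' : ∀ x : ℝ, (1 - x) * x ^ k = x ^ k - x ^ (k + 1) := fun x => by ring
  simp only [h']
  rw [intervalIntegral.integral_sub (Continuous.intervalIntegrable (by fun_prop) _ _)
    (Continuous.intervalIntegrable (by fun_prop) _ _), integral_pow, integral_pow]
  have h1 : (k : ℝ) + 1 ≠ 0 := by positivity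
  have h2 : (k : ℝ) + 2 ≠ 0 := by positivity
  have h3 : (k : ℝ) + 1 + 1 ≠ 0 := by positivity
  push_cast
  simp only [one_pow, zero_pow (Nat.succ_ne_zero _)]
  field_simp
  ring

lemma integral_Icc_prod_mul_one_sub_pow (n k : ℕ) :
    ∫ x in Set.Icc (0 : Fin n → ℝ) 1, ∏ i, x i * (1 - x i) ^ k =
      1 / (((k : ℝ) + 1) ^ n * (k + 2) ^ n) := by
  rw [← Set.pi_univ_Icc, volume_pi, Measure.restrict_pi_pi]
  simp only [Pi.zero_apply, Pi.one_apply]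
  rw [integral_fintype_prod_eq_prod (𝕜 := ℝ) (f := fun _ t => t * (1 - t) ^ k)]
  simp [integral_Icc_mul_one_sub_pow, mul_pow]

/-- On the unit cube, the product of the `1 - x i` is at most their mean. -/
lemma prod_one_sub_le_one_sub_mean {n : ℕ} (hn : 1 ≤ n) {x : Fin n → ℝ}
    (hx : x ∈ Set.Icc (0 : Fin n → ℝ) 1) :
    ∏ i, (1 - x i) ≤ 1 - (∑ i, x i) / n := by
  have h : ∀ i, ∏ j, (1 - x j) ≤ 1 - x i := fun i => by
    rw [← Finset.mul_prod_erase _ _ (Finset.mem_univ i)]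
    refine mul_le_of_le_one_right (sub_nonneg.2 (hx.2 i)) (Finset.prod_le_one ?_ ?_)
    · exact fun j _ => sub_nonneg.2 (hx.2 j)
    · exact fun j _ => sub_le_self _ (hx.1 j)
  have hsum := Finset.sum_le_sum fun i (_ : i ∈ Finset.univ) => h i
  simp only [Finset.sum_const, Finset.card_univ, Fintype.card_fin, nsmul_eq_mul,
    Finset.sum_sub_distrib, mul_one] at hsum
  have hn' : (0 : ℝ) < n := by exact_mod_cast hn
  rw [one_sub_div hn'.ne', le_div_iff₀ hn']
  linarith

/-- For every integer `n ≥ 1` and every real `m ≥ 0`, the integral over the unit cube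
`[0,1]^n` of `x₁ ⋯ xₙ · (1 − (x₁ + ⋯ + xₙ)/n)^m` is at least
`1/((⌈m⌉+1)^n (⌈m⌉+2)^n)`. -/
theorem stmt0 (n : ℕ) (hn : 1 ≤ n) (m : ℝ) (hm : 0 ≤ m) :
    ∫ x in Set.Icc (0 : Fin n → ℝ) 1,
      (∏ i, x i) * (1 - (∑ i, x i) / n) ^ m ≥
      1 / (((⌈m⌉ : ℝ) + 1) ^ n * ((⌈m⌉ : ℝ) + 2) ^ n) := by
  have hk : (⌈m⌉ : ℝ) = (⌈m⌉₊ : ℝ) := (natCast_ceil_eq_intCast_ceil hm).symm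
  rw [hk, ge_iff_le, ← integral_Icc_prod_mul_one_sub_pow]
  refine setIntegral_mono_on ?_ ?_ measurableSet_Icc fun x hx => ?_
  · exact Continuous.integrableOn_Icc (by fun_prop)
  · refine Continuous.integrableOn_Icc (.mul (by fun_prop) ?_)
    exact Continuous.rpow_const (by fun_prop) fun _ => Or.inr hm
  have hprod : 0 ≤ ∏ i, (1 - x i) := Finset.prod_nonneg fun i _ => sub_nonneg.2 (hx.2 i)
  have hle := prod_one_sub_le_one_sub_mean hn hx
  have hsum : 0 ≤ (∑ i, x i) / n :=
    div_nonneg (Finset.sum_nonneg fun i _ => hx.1 i) n.cast_nonneg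
  rw [Finset.prod_mul_distrib, Finset.prod_pow]
  refine mul_le_mul_of_nonneg_left ?_ (Finset.prod_nonneg fun i _ => hx.1 i)
  calc (∏ i, (1 - x i)) ^ ⌈m⌉₊ ≤ (1 - (∑ i, x i) / n) ^ ⌈m⌉₊ := by gcongr
    _ = (1 - (∑ i, x i) / n) ^ (⌈m⌉₊ : ℝ) := (Real.rpow_natCast _ _).symm
    _ ≤ (1 - (∑ i, x i) / n) ^ m :=
      Real.rpow_le_rpow_of_exponent_ge_of_imp (hprod.trans hle) (sub_le_self _ hsum)
        (Nat.le_ceil m) fun _ h => hm.antisymm' (h ▸ Nat.le_ceil m)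
end

section
/- For every norm N on ℝ^n one has −n·log 6 ≤ ĥ⁰(N) − ĥ¹(N) − χ̂(N) ≤ n·log(3/2) + 2·log(n!). -/
open MeasureTheory

/-- `N` is a norm on `ℝ^n`. -/
def IsNorm (n : ℕ) (N : (Fin n → ℝ) → ℝ) : Prop :=
  (∀ x, N x = 0 ↔ x = 0) ∧ (∀ (c : ℝ) (x), N (c • x) = |c| * N x) ∧
    (∀ x y, N (x + y) ≤ N x + N y)

/-- `ĥ⁰(N) = log #(ℤ^n ∩ B(N))`, the log of the number of lattice points in the unit
ball of `N`. -/
noncomputable def h0Hat (n : ℕ) (N : (Fin n → ℝ) → ℝ) : ℝ :=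
  Real.log (Nat.card {x : Fin n → ℤ // N (fun i => (x i : ℝ)) ≤ 1})

/-- `ĥ¹(N) = log #{x ∈ ℤ^n : |⟨x,y⟩| ≤ 1 for all y ∈ B(N)}`. -/
noncomputable def h1Hat (n : ℕ) (N : (Fin n → ℝ) → ℝ) : ℝ :=
  Real.log (Nat.card {x : Fin n → ℤ //
    ∀ y : Fin n → ℝ, N y ≤ 1 → |∑ i, (x i : ℝ) * y i| ≤ 1})

/-- `χ̂(N) = log vol(B(N))`. -/
noncomputable def chiHat (n : ℕ) (N : (Fin n → ℝ) → ℝ) : ℝ :=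
  Real.log (volume {x : Fin n → ℝ | N x ≤ 1}).toReal

/-- **Blichfeldt's principle**: if every lattice vector that is a difference of two points of a
measurable set `A` lies in the finite set `T`, then `vol A ≤ #T`. -/
theorem volume_le_card_of_sub_mem {n : ℕ} {A : Set (Fin n → ℝ)} (hA : MeasurableSet A)
    (T : Finset (Fin n → ℤ))
    (hT : ∀ z : Fin n → ℤ, (∃ a ∈ A, ∃ a' ∈ A, ∀ i, (z i : ℝ) = a i - a' i) → z ∈ T) :
    volume A ≤ (T.card : ENNReal) := by
  classical
  let L := (Submodule.span ℤ (Set.range (Pi.basisFun ℝ (Fin n)))).toAddSubgroup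
  have : Countable L :=
    inferInstanceAs (Countable (Submodule.span ℤ (Set.range (Pi.basisFun ℝ (Fin n)))))
  have hint : ∀ g : L, ∀ i, ((⌊(g : Fin n → ℝ) i⌋ : ℤ) : ℝ) = (g : Fin n → ℝ) i := by
    intro g i
    obtain ⟨k, hk⟩ := ((Pi.basisFun ℝ (Fin n)).mem_span_iff_repr_mem ℤ _).1 g.2 i
    simp only [Pi.basisFun_repr, algebraMap_int_eq, eq_intCast] at hk
    rw [← hk, Int.floor_intCast]
  have hF : IsAddFundamentalDomain L (ZSpan.fundamentalDomain (Pi.basisFun ℝ (Fin n)))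
      (volume : Measure (Fin n → ℝ)) := ZSpan.isAddFundamentalDomain' _ _
  have hvolF : volume (ZSpan.fundamentalDomain (Pi.basisFun ℝ (Fin n))) = 1 := by
    rw [ZSpan.fundamentalDomain_pi_basisFun, volume_pi_pi]
    simp
  have key : ∀ x : Fin n → ℝ,
      ∑' g : L, A.indicator (fun _ => (1 : ENNReal)) (-g +ᵥ x) ≤ (T.card : ENNReal) := by
    intro x
    rw [ENNReal.tsum_eq_iSup_sum]
    refine iSup_le fun s => ?_
    have hsum : ∑ g ∈ s, A.indicator (fun _ => (1 : ENNReal)) (-g +ᵥ x) =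
        ((s.filter fun g : L => -g +ᵥ x ∈ A).card : ENNReal) := by
      simp [Set.indicator_apply]
    rw [hsum]
    rcases (s.filter fun g : L => -g +ᵥ x ∈ A).eq_empty_or_nonempty with h | ⟨g₀, hg₀⟩
    · simp [h]
    · norm_cast
      refine Finset.card_le_card_of_injOn
        (fun g i => ⌊(g₀ : Fin n → ℝ) i⌋ - ⌊(g : Fin n → ℝ) i⌋) ?_ ?_
      · intro g hg
        refine hT _ ⟨-g +ᵥ x, (Finset.mem_filter.1 hg).2, -g₀ +ᵥ x,
          (Finset.mem_filter.1 hg₀).2, fun i => ?_⟩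
        push_cast
        rw [hint, hint]
        simp [AddSubgroup.vadd_def]
        ring
      · intro g _ g' _ h
        ext i
        have := congrFun h i
        simp only [sub_right_inj] at this
        rw [← hint g i, ← hint g' i, this]
  calc volume A = ∫⁻ x, A.indicator (fun _ => (1 : ENNReal)) x := by
        rw [lintegral_indicator hA]; simp
    _ = ∑' g : L, ∫⁻ x in ZSpan.fundamentalDomain (Pi.basisFun ℝ (Fin n)),
          A.indicator (fun _ => (1 : ENNReal)) (-g +ᵥ x) := hF.lintegral_eq_tsum' _
    _ = ∫⁻ x in ZSpan.fundamentalDomain (Pi.basisFun ℝ (Fin n)),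
          ∑' g : L, A.indicator (fun _ => (1 : ENNReal)) (-g +ᵥ x) := by
        rw [lintegral_tsum]
        intro g
        exact ((measurable_const.indicator hA).comp (measurable_const_vadd (-g))).aemeasurable
    _ ≤ ∫⁻ _ in ZSpan.fundamentalDomain (Pi.basisFun ℝ (Fin n)), (T.card : ENNReal) :=
        lintegral_mono key
    _ = T.card := by simp [hvolF]

/-- A nonzero integral linear form becomes a positive multiple of the first coordinate in a
suitable basis of the lattice. -/
theorem exists_basis_form_eq_mul_coord {m : ℕ} (f : (Fin (m + 1) → ℤ) →ₗ[ℤ] ℤ) (hf : f ≠ 0) :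
    ∃ (b : Module.Basis (Fin (m + 1)) ℤ (Fin (m + 1) → ℤ)) (d : ℤ), d ≠ 0 ∧ f (b 0) = d ∧
      ∀ j : Fin m, f (b j.succ) = 0 := by
  obtain ⟨d, hd⟩ := (IsPrincipalIdealRing.principal (LinearMap.range f)).principal
  have hd0 : d ≠ 0 := by
    rintro rfl
    apply hf
    rw [← LinearMap.range_eq_bot, hd]
    simp
  obtain ⟨v, hv⟩ : d ∈ LinearMap.range f := by rw [hd]; exact Submodule.mem_span_singleton_self d
  obtain ⟨r, ⟨b⟩⟩ := (LinearMap.ker f).nonempty_basis_of_pid (Pi.basisFun ℤ (Fin (m + 1)))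
  have hli : ∀ (c : ℤ), ∀ x ∈ LinearMap.ker f, c • v + x = 0 → c = 0 := by
    intro c x hx h
    have := congrArg f h
    rw [map_add, map_smul, LinearMap.mem_ker.1 hx, hv] at this
    simpa [hd0] using this
  have hsp : ∀ z, ∃ c : ℤ, z + c • v ∈ LinearMap.ker f := by
    intro z
    have : f z ∈ LinearMap.range f := ⟨z, rfl⟩
    rw [hd] at this
    obtain ⟨c, hc⟩ := Submodule.mem_span_singleton.1 this
    refine ⟨-c, ?_⟩
    rw [LinearMap.mem_ker, map_add, map_smul, hv, ← hc]
    simp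
  let B := Module.Basis.mkFinCons v b hli hsp
  have hr : r = m := by
    have := Fintype.card_congr (B.indexEquiv (Pi.basisFun ℤ (Fin (m + 1))))
    simpa using this
  subst hr
  refine ⟨B, d, hd0, ?_, fun j => ?_⟩
  · simp [B, Module.Basis.coe_mkFinCons, hv]
  · simp [B, Module.Basis.coe_mkFinCons]

/-- A finite set of integers of diameter at most `2 / r`, with `0 ≤ r ≤ 1`, has at most `3 / r`
elements. -/
theorem mul_card_le_three_of_mul_abs_sub_le_two {r : ℝ} (hr0 : 0 ≤ r) (hr1 : r ≤ 1) (s : Finset ℤ)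
    (hs : ∀ k ∈ s, ∀ k' ∈ s, |((k - k' : ℤ) : ℝ)| * r ≤ 2) : (s.card : ℝ) * r ≤ 3 := by
  rcases s.eq_empty_or_nonempty with rfl | hne
  · simp
  have hsub : s ⊆ Finset.Icc (s.min' hne) (s.max' hne) := fun k hk =>
    Finset.mem_Icc.2 ⟨s.min'_le k hk, s.le_max' k hk⟩
  have hle : s.min' hne ≤ s.max' hne := s.min'_le_max' hne
  have hcard : (s.card : ℤ) ≤ s.max' hne - s.min' hne + 1 := by
    have := Finset.card_le_card hsub
    rw [Int.card_Icc] at this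
    lia
  have hcard' : (s.card : ℝ) ≤ ((s.max' hne - s.min' hne : ℤ) : ℝ) + 1 := by exact_mod_cast hcard
  have h2 := hs _ (s.max'_mem hne) _ (s.min'_mem hne)
  have h3 := le_abs_self ((s.max' hne - s.min' hne : ℤ) : ℝ)
  nlinarith

/-- The inductive bound on `vol A * #S`, for sets of width at most one in the first coordinate
direction, in terms of the bound for the slices of `A`. -/
theorem volume_mul_card_le_of_slices {m : ℕ} {c : ENNReal} {A : Set (Fin (m + 1) → ℝ)}
    (hA : MeasurableSet A)
    (hA1 : ∀ a ∈ A, ∀ a' ∈ A, |a 0 - a' 0| ≤ 1) (S : Finset (Fin (m + 1) → ℤ))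
    (hS : ∀ y ∈ S, ∀ a ∈ A, ∀ a' ∈ A, |∑ i, (y i : ℝ) * (a i - a' i)| ≤ 1)
    (hslice : ∀ t : ℝ, volume {x : Fin m → ℝ | (Fin.cons t x : Fin (m + 1) → ℝ) ∈ A} *
      ((S.image (Fin.tail : (Fin (m + 1) → ℤ) → Fin m → ℤ)).card : ENNReal) ≤ c) :
    volume A * (S.card : ENNReal) ≤ 3 * c := by
  classical
  rcases S.eq_empty_or_nonempty with rfl | hSne
  · simp
  set S' := S.image (Fin.tail : (Fin (m + 1) → ℤ) → Fin m → ℤ) with hS'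
  set I : Set ℝ := (fun a : Fin (m + 1) → ℝ => a 0) '' A with hI
  set r := Metric.diam I with hr
  have hr0 : 0 ≤ r := Metric.diam_nonneg
  have hdist : ∀ x ∈ I, ∀ y ∈ I, dist x y ≤ 1 := by
    rintro _ ⟨a, ha, rfl⟩ _ ⟨a', ha', rfl⟩
    exact hA1 a ha a' ha'
  have hr1 : r ≤ 1 := Metric.diam_le_of_forall_dist_le zero_le_one hdist
  have hbdd : Bornology.IsBounded I := Metric.isBounded_iff.2 ⟨1, fun x hx y hy => hdist x hx y hy⟩
  have hIcc := hbdd.subset_Icc_sInf_sSup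
  have hvol : volume A * (S'.card : ENNReal) ≤ ENNReal.ofReal r * c := by
    let e := MeasurableEquiv.piFinSuccAbove (fun _ : Fin (m + 1) => ℝ) 0
    have hpres := volume_preserving_piFinSuccAbove (fun _ : Fin (m + 1) => ℝ) 0
    have hAe : volume A = volume (e.symm ⁻¹' A) :=
      (hpres.symm.measure_preimage hA.nullMeasurableSet).symm
    have hmk : ∀ t : ℝ, Prod.mk t ⁻¹' (e.symm ⁻¹' A) =
        {x : Fin m → ℝ | (Fin.cons t x : Fin (m + 1) → ℝ) ∈ A} := by
      intro t
      ext x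
      simp [e, MeasurableEquiv.piFinSuccAbove]
      rfl
    have hmeas : MeasurableSet (e.symm ⁻¹' A) := e.symm.measurable hA
    rw [hAe, Measure.volume_eq_prod, Measure.prod_apply hmeas, ← lintegral_mul_const'
      _ _ (ENNReal.natCast_ne_top _)]
    simp_rw [hmk]
    calc ∫⁻ t, volume {x : Fin m → ℝ | (Fin.cons t x : Fin (m + 1) → ℝ) ∈ A} * (S'.card : ENNReal)
        ≤ ∫⁻ t, (Set.Icc (sInf I) (sSup I)).indicator (fun _ => c) t := by
          refine lintegral_mono fun t => ?_
          by_cases ht : t ∈ Set.Icc (sInf I) (sSup I)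
          · rw [Set.indicator_of_mem ht]
            exact hslice t
          · have : {x : Fin m → ℝ | (Fin.cons t x : Fin (m + 1) → ℝ) ∈ A} = ∅ := by
              refine Set.eq_empty_of_forall_notMem fun x hx => ht (hIcc ⟨_, hx, ?_⟩)
              simp
            simp [this]
      _ = ENNReal.ofReal r * c := by
          rw [lintegral_indicator measurableSet_Icc, setLIntegral_const, Real.volume_Icc, hr,
            Real.diam_eq hbdd, mul_comm]
  have hcard : (S.card : ENNReal) * ENNReal.ofReal r ≤ 3 * (S'.card : ENNReal) := by
    have hfib : ∀ b ∈ S', ((S.filter fun y => Fin.tail y = b).card : ℝ) * r ≤ 3 := by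
      intro b _
      have hinj : Set.InjOn (fun y : Fin (m + 1) → ℤ => y 0)
          (S.filter fun y => Fin.tail y = b) := by
        intro y hy y' hy' h
        have h1 := (Finset.mem_filter.1 hy).2
        have h2 := (Finset.mem_filter.1 hy').2
        rw [← Fin.cons_self_tail y, ← Fin.cons_self_tail y', h1, h2]
        exact congrArg (fun k => (Fin.cons k b : Fin (m + 1) → ℤ)) h
      rw [← Finset.card_image_of_injOn hinj]
      refine mul_card_le_three_of_mul_abs_sub_le_two hr0 hr1 _ ?_
      intro k hk k' hk'
      obtain ⟨y, hy, rfl⟩ := Finset.mem_image.1 hk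
      obtain ⟨y', hy', rfl⟩ := Finset.mem_image.1 hk'
      obtain ⟨hyS, hyb⟩ := Finset.mem_filter.1 hy
      obtain ⟨hyS', hyb'⟩ := Finset.mem_filter.1 hy'
      rcases eq_or_ne (y 0 - y' 0) 0 with h0 | h0
      · simp [h0]
      have hpos : 0 < |((y 0 - y' 0 : ℤ) : ℝ)| := abs_pos.2 (by exact_mod_cast h0)
      rw [mul_comm, ← le_div_iff₀ hpos]
      refine Metric.diam_le_of_forall_dist_le (by positivity) ?_
      rintro _ ⟨a, ha, rfl⟩ _ ⟨a', ha', rfl⟩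
      rw [le_div_iff₀ hpos, Real.dist_eq, ← abs_mul]
      have e1 := hS y hyS a ha a' ha'
      have e2 := hS y' hyS' a ha a' ha'
      have htail : ∀ j : Fin m, y j.succ = y' j.succ := fun j =>
        congrFun (hyb.trans hyb'.symm) j
      rw [Fin.sum_univ_succ] at e1 e2
      simp only [htail] at e1
      rw [abs_le] at e1 e2 ⊢
      push_cast
      constructor <;> nlinarith
    have hreal : (S.card : ℝ) * r ≤ 3 * S'.card := by
      rw [Finset.card_eq_sum_card_image Fin.tail S, Nat.cast_sum, Finset.sum_mul, mul_comm 3]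
      exact (Finset.sum_le_card_nsmul _ _ 3 hfib).trans_eq (by simp [hS'])
    have := ENNReal.ofReal_le_ofReal hreal
    rwa [ENNReal.ofReal_mul (by positivity), ENNReal.ofReal_mul (by positivity),
      ENNReal.ofReal_natCast, ENNReal.ofReal_natCast, ENNReal.ofReal_ofNat] at this
  have hS'0 : (S'.card : ENNReal) ≠ 0 := by
    simpa [hS'] using hSne.ne_empty
  rcases hr0.eq_or_lt with h0 | hpos
  · rw [← h0] at hvol
    simp only [ENNReal.ofReal_zero, zero_mul, nonpos_iff_eq_zero, mul_eq_zero, hS'0, or_false]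
      at hvol
    simp [hvol]
  · have hr_ne : ENNReal.ofReal r ≠ 0 := by simpa using hpos
    refine (ENNReal.mul_le_mul_iff_right hr_ne ENNReal.ofReal_ne_top).1 ?_
    calc ENNReal.ofReal r * (volume A * (S.card : ENNReal))
        = volume A * ((S.card : ENNReal) * ENNReal.ofReal r) := by ring
      _ ≤ volume A * (3 * (S'.card : ENNReal)) := by gcongr
      _ = 3 * (volume A * (S'.card : ENNReal)) := by ring
      _ ≤ 3 * (ENNReal.ofReal r * c) := by gcongr
      _ = ENNReal.ofReal r * (3 * c) := by ring

/-- A nonzero integral row vector becomes a multiple of the first coordinate vector after a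
unimodular change of coordinates. -/
theorem exists_isUnit_vecMul_eq_cons {m : ℕ} {y : Fin (m + 1) → ℤ} (hy : y ≠ 0) :
    ∃ P : Matrix (Fin (m + 1)) (Fin (m + 1)) ℤ, IsUnit P ∧
      ∃ d : ℤ, d ≠ 0 ∧ Matrix.vecMul y P = Fin.cons d 0 := by
  let f : (Fin (m + 1) → ℤ) →ₗ[ℤ] ℤ := dotProductBilin ℤ ℤ y
  have hf_apply : ∀ x, f x = y ⬝ᵥ x := fun x => rfl
  have hf : f ≠ 0 := by
    intro h
    apply hy
    ext i
    have := hf_apply (Pi.single i 1)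
    rw [h] at this
    simpa using this.symm
  obtain ⟨b, d, hd0, hbd, hbs⟩ := exists_basis_form_eq_mul_coord f hf
  let P : Matrix (Fin (m + 1)) (Fin (m + 1)) ℤ := (Pi.basisFun ℤ (Fin (m + 1))).toMatrix b
  have hP : ∀ i j, P i j = b j i := fun i j => by simp [P, Module.Basis.toMatrix_apply]
  refine ⟨P, IsUnit.of_mul_eq_one _ ((Pi.basisFun ℤ _).toMatrix_mul_toMatrix_flip b), d, hd0, ?_⟩
  have h1 : ∀ j, Matrix.vecMul y P j = f (b j) := fun j => by
    simp [hf_apply, Matrix.vecMul, dotProduct, hP]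
  ext j
  refine Fin.cases ?_ (fun k => ?_) j
  · rw [h1, hbd]; rfl
  · rw [h1, hbs]; rfl

/-- Unimodular integral matrices preserve the volume. -/
theorem volume_preimage_mulVec_map_intCast {n : ℕ} {P : Matrix (Fin n) (Fin n) ℤ} (hP : IsUnit P)
    (A : Set (Fin n → ℝ)) :
    volume ((P.map (Int.castRingHom ℝ)).mulVec ⁻¹' A) = volume A := by
  have hdet : |(P.map (Int.castRingHom ℝ)).det| = 1 := by
    have : (P.map (Int.castRingHom ℝ)).det = (P.det : ℝ) :=
      (RingHom.map_det (Int.castRingHom ℝ) P).symm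
    rw [this]
    exact_mod_cast Int.isUnit_iff_abs_eq.1 ((Matrix.isUnit_iff_isUnit_det _).1 hP)
  have hne : LinearMap.det (Matrix.toLin' (P.map (Int.castRingHom ℝ))) ≠ 0 := by
    rw [LinearMap.det_toLin']
    intro h
    rw [h] at hdet
    simp at hdet
  have := Measure.addHaar_preimage_linearMap volume hne A
  rw [LinearMap.det_toLin', abs_inv, hdet, inv_one, ENNReal.ofReal_one, one_mul] at this
  exact this

/-- The inductive step of `volume_mul_card_le`, for sets of width at most one in the first
coordinate direction. -/
theorem volume_mul_card_le_succ {m : ℕ}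
    (ih : ∀ {B : Set (Fin m → ℝ)}, MeasurableSet B → ∀ S T : Finset (Fin m → ℤ),
      (∀ y ∈ S, ∀ a ∈ B, ∀ a' ∈ B, |∑ i, (y i : ℝ) * (a i - a' i)| ≤ 1) →
      (∀ z : Fin m → ℤ, (∃ a ∈ B, ∃ a' ∈ B, ∀ i, (z i : ℝ) = a i - a' i) → z ∈ T) →
      volume B * (S.card : ENNReal) ≤ 3 ^ m * (T.card : ENNReal))
    {A : Set (Fin (m + 1) → ℝ)} (hA : MeasurableSet A)
    (hA1 : ∀ a ∈ A, ∀ a' ∈ A, |a 0 - a' 0| ≤ 1) (S T : Finset (Fin (m + 1) → ℤ))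
    (hS : ∀ y ∈ S, ∀ a ∈ A, ∀ a' ∈ A, |∑ i, (y i : ℝ) * (a i - a' i)| ≤ 1)
    (hT : ∀ z : Fin (m + 1) → ℤ, (∃ a ∈ A, ∃ a' ∈ A, ∀ i, (z i : ℝ) = a i - a' i) → z ∈ T) :
    volume A * (S.card : ENNReal) ≤ 3 ^ (m + 1) * (T.card : ENNReal) := by
  classical
  have hcons : ∀ t : ℝ, Measurable fun x : Fin m → ℝ => (Fin.cons t x : Fin (m + 1) → ℝ) := by
    intro t
    refine measurable_pi_iff.2 fun i => ?_
    refine Fin.cases ?_ (fun k => ?_) i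
    · simp
    · simpa using measurable_pi_apply k
  rw [pow_succ', mul_assoc]
  refine volume_mul_card_le_of_slices hA hA1 S hS fun t => ?_
  let tail : (Fin (m + 1) → ℤ) → Fin m → ℤ := Fin.tail
  refine (ih (hcons t hA) (S.image tail) (T.image tail) ?_ ?_).trans ?_
  · intro w hw a ha a' ha'
    obtain ⟨w, hw', rfl⟩ := Finset.mem_image.1 hw
    have := hS w hw' _ ha _ ha'
    rw [Fin.sum_univ_succ] at this
    simpa [Fin.tail, tail] using this
  · rintro z ⟨a, ha, a', ha', h⟩
    refine Finset.mem_image.2 ⟨(Fin.cons 0 z : Fin (m + 1) → ℤ), hT _ ⟨_, ha, _, ha', fun i => ?_⟩,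
      Fin.tail_cons (α := fun _ => ℤ) _ _⟩
    refine Fin.cases ?_ (fun k => ?_) i
    · simp
    · simpa using h k
  · gcongr
    exact Finset.card_image_le

/-- If `A` is a measurable set, `S` consists of integral linear forms of width at most one on `A`,
and `T` contains all lattice vectors in `A - A`, then `vol A * #S ≤ 3 ^ n * #T`. -/
theorem volume_mul_card_le {n : ℕ} {A : Set (Fin n → ℝ)} (hA : MeasurableSet A)
    (S T : Finset (Fin n → ℤ))
    (hS : ∀ y ∈ S, ∀ a ∈ A, ∀ a' ∈ A, |∑ i, (y i : ℝ) * (a i - a' i)| ≤ 1)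
    (hT : ∀ z : Fin n → ℤ, (∃ a ∈ A, ∃ a' ∈ A, ∀ i, (z i : ℝ) = a i - a' i) → z ∈ T) :
    volume A * (S.card : ENNReal) ≤ 3 ^ n * (T.card : ENNReal) := by
  classical
  induction n with
  | zero =>
    have hcard : S.card ≤ 1 := Finset.card_le_one_of_subsingleton S
    calc volume A * (S.card : ENNReal) ≤ T.card * ((1 : ℕ) : ENNReal) := by
          gcongr
          exact volume_le_card_of_sub_mem hA T hT
      _ = 3 ^ 0 * (T.card : ENNReal) := by simp
  | succ m ih =>
    by_cases h0 : ∀ y ∈ S, y = 0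
    · have hcard : S.card ≤ 1 :=
        Finset.card_le_one.2 fun a ha b hb => (h0 a ha).trans (h0 b hb).symm
      calc volume A * (S.card : ENNReal) ≤ T.card * ((1 : ℕ) : ENNReal) := by
            gcongr
            exact volume_le_card_of_sub_mem hA T hT
        _ = 1 * (T.card : ENNReal) := by simp
        _ ≤ 3 ^ (m + 1) * (T.card : ENNReal) := by
            gcongr
            exact one_le_pow₀ (by norm_num)
    push Not at h0
    obtain ⟨y, hyS, hy0⟩ := h0
    obtain ⟨P, hPunit, d, hd0, hyP⟩ := exists_isUnit_vecMul_eq_cons hy0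
    let R : Matrix (Fin (m + 1)) (Fin (m + 1)) ℝ := P.map (Int.castRingHom ℝ)
    have hPinj : Function.Injective P.mulVec := Matrix.mulVec_injective_of_isUnit hPunit
    have hPinj' : Function.Injective fun w => Matrix.vecMul w P :=
      Matrix.vecMul_injective_of_isUnit hPunit
    have hRP : ∀ z : Fin (m + 1) → ℤ, ∀ i, (((P.mulVec z) i : ℤ) : ℝ) =
        R.mulVec (fun j => (z j : ℝ)) i := by
      intro z i
      simp [Matrix.mulVec, dotProduct, R]
    have hadj : ∀ (w : Fin (m + 1) → ℤ) (x : Fin (m + 1) → ℝ),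
        ∑ i, (((Matrix.vecMul w P) i : ℤ) : ℝ) * x i = ∑ i, (w i : ℝ) * R.mulVec x i := by
      intro w x
      have h1 : (fun i => (((Matrix.vecMul w P) i : ℤ) : ℝ)) =
          Matrix.vecMul (fun i => (w i : ℝ)) R := by
        ext i
        simp [Matrix.vecMul, dotProduct, R]
      exact (congrArg (· ⬝ᵥ x) h1).trans (Matrix.dotProduct_mulVec _ _ _).symm
    have hA' : MeasurableSet (R.mulVec ⁻¹' A) :=
      (LinearMap.continuous_of_finiteDimensional (Matrix.toLin' R)).measurable hA
    have hsub : ∀ a a' : Fin (m + 1) → ℝ, ∀ i,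
        R.mulVec (fun j => a j - a' j) i = R.mulVec a i - R.mulVec a' i := by
      intro a a' i
      exact congrFun (Matrix.mulVec_sub R a a') i
    have hS' : ∀ w ∈ S.image fun w => Matrix.vecMul w P, ∀ a ∈ R.mulVec ⁻¹' A,
        ∀ a' ∈ R.mulVec ⁻¹' A, |∑ i, (w i : ℝ) * (a i - a' i)| ≤ 1 := by
      intro w hw a ha a' ha'
      obtain ⟨w, hwS, rfl⟩ := Finset.mem_image.1 hw
      rw [hadj w fun i => a i - a' i]
      simp_rw [hsub]
      exact hS w hwS _ ha _ ha'
    have hT' : ∀ z : Fin (m + 1) → ℤ, (∃ a ∈ R.mulVec ⁻¹' A, ∃ a' ∈ R.mulVec ⁻¹' A,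
        ∀ i, (z i : ℝ) = a i - a' i) → z ∈ T.preimage P.mulVec hPinj.injOn := by
      rintro z ⟨a, ha, a', ha', h⟩
      refine Finset.mem_preimage.2 (hT _ ⟨_, ha, _, ha', fun i => ?_⟩)
      rw [hRP, ← hsub]
      simp_rw [h]
    have hwidth : ∀ a ∈ R.mulVec ⁻¹' A, ∀ a' ∈ R.mulVec ⁻¹' A, |a 0 - a' 0| ≤ 1 := by
      intro a ha a' ha'
      have h1 := hS' _ (Finset.mem_image_of_mem _ hyS) a ha a' ha'
      rw [hyP, Fin.sum_univ_succ] at h1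
      simp only [Fin.cons_zero, Fin.cons_succ, Pi.zero_apply, Int.cast_zero, zero_mul,
        Finset.sum_const_zero, add_zero, abs_mul] at h1
      have h2 : (1 : ℝ) ≤ |(d : ℝ)| := by exact_mod_cast Int.one_le_abs hd0
      nlinarith [abs_nonneg (a 0 - a' 0)]
    have hT'card : (T.preimage P.mulVec hPinj.injOn).card ≤ T.card :=
      Finset.card_le_card_of_injOn P.mulVec (fun z hz => Finset.mem_preimage.1 hz) hPinj.injOn
    have key := volume_mul_card_le_succ ih hA' hwidth _ _ hS' hT'
    rw [volume_preimage_mulVec_map_intCast hPunit, Finset.card_image_of_injective _ hPinj'] at key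
    refine key.trans ?_
    gcongr

namespace IsNorm

variable {n : ℕ} {N : (Fin n → ℝ) → ℝ}

theorem map_zero (hN : IsNorm n N) : N 0 = 0 := (hN.1 0).2 rfl

theorem map_neg (hN : IsNorm n N) (x : Fin n → ℝ) : N (-x) = N x := by
  simpa using hN.2.1 (-1) x

theorem nonneg (hN : IsNorm n N) (x : Fin n → ℝ) : 0 ≤ N x := by
  have h := hN.2.2 x (-x)
  rw [add_neg_cancel, hN.map_zero, hN.map_neg] at h
  linarith

theorem pos (hN : IsNorm n N) {x : Fin n → ℝ} (hx : x ≠ 0) : 0 < N x :=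
  (hN.nonneg x).lt_of_ne fun h => hx ((hN.1 x).1 h.symm)

theorem map_sum_smul_le (hN : IsNorm n N) {ι : Type*} (s : Finset ι) (c : ι → ℝ)
    (v : ι → Fin n → ℝ) : N (∑ i ∈ s, c i • v i) ≤ ∑ i ∈ s, |c i| * N (v i) :=
  (Finset.le_sum_of_subadditive N hN.map_zero.le hN.2.2 s _).trans_eq
    (Finset.sum_congr rfl fun i _ => hN.2.1 (c i) (v i))

theorem exists_le_mul_norm (hN : IsNorm n N) : ∃ C : ℝ, 0 < C ∧ ∀ x, N x ≤ C * ‖x‖ := by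
  refine ⟨∑ i, N (Pi.single i 1) + 1, ?_, fun x => ?_⟩
  · have := Finset.sum_nonneg fun i (_ : i ∈ Finset.univ) => hN.nonneg (Pi.single i 1)
    linarith
  · have hx : x = ∑ i, x i • (Pi.single i 1 : Fin n → ℝ) := pi_eq_sum_univ' x
    calc N x ≤ ∑ i, |x i| * N (Pi.single i 1) := by
          conv_lhs => rw [hx]
          exact hN.map_sum_smul_le _ _ _
      _ ≤ ∑ i, ‖x‖ * N (Pi.single i 1) := by
          gcongr with i
          · exact hN.nonneg _
          · exact norm_le_pi_norm x i
      _ ≤ (∑ i, N (Pi.single i 1) + 1) * ‖x‖ := by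
          rw [← Finset.mul_sum]
          nlinarith [norm_nonneg x]

theorem continuous (hN : IsNorm n N) : Continuous N := by
  obtain ⟨C, hC, h⟩ := hN.exists_le_mul_norm
  refine (LipschitzWith.of_le_add_mul C.toNNReal fun x y => ?_).continuous
  have h1 := hN.2.2 y (x - y)
  have h2 := h (x - y)
  rw [add_sub_cancel] at h1
  rw [Real.coe_toNNReal _ hC.le, dist_eq_norm]
  linarith

theorem exists_mul_norm_le (hN : IsNorm n N) : ∃ c : ℝ, 0 < c ∧ ∀ x, c * ‖x‖ ≤ N x := by
  rcases (Metric.sphere (0 : Fin n → ℝ) 1).eq_empty_or_nonempty with he | hne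
  · refine ⟨1, one_pos, fun x => ?_⟩
    have hx : x = 0 := by
      by_contra hx
      have : ‖x‖⁻¹ • x ∈ Metric.sphere (0 : Fin n → ℝ) 1 := by
        simp [norm_smul, hx]
      simp [he] at this
    simp [hx, hN.map_zero]
  · obtain ⟨u, hu, hmin⟩ := (isCompact_sphere (0 : Fin n → ℝ) 1).exists_isMinOn hne
      hN.continuous.continuousOn
    have hu0 : u ≠ 0 := by
      rintro rfl
      simp at hu
    refine ⟨N u, hN.pos hu0, fun x => ?_⟩
    rcases eq_or_ne x 0 with rfl | hx
    · simp [hN.map_zero]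
    · have hmem : ‖x‖⁻¹ • x ∈ Metric.sphere (0 : Fin n → ℝ) 1 := by simp [norm_smul, hx]
      have h1 : N u ≤ N (‖x‖⁻¹ • x) := hmin hmem
      have hpos : 0 < ‖x‖ := norm_pos_iff.2 hx
      rw [hN.2.1, abs_of_pos (inv_pos.2 hpos), inv_mul_eq_div, le_div_iff₀ hpos] at h1
      exact h1

theorem isCompact_ball (hN : IsNorm n N) : IsCompact {x | N x ≤ 1} := by
  obtain ⟨c, hc, h⟩ := hN.exists_mul_norm_le
  refine Metric.isCompact_of_isClosed_isBounded (isClosed_le hN.continuous continuous_const) ?_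
  refine (Metric.isBounded_closedBall (x := (0 : Fin n → ℝ)) (r := c⁻¹)).subset fun x hx => ?_
  rw [mem_closedBall_zero_iff, ← mul_le_mul_iff_right₀ hc, mul_inv_cancel₀ hc.ne']
  exact (h x).trans hx

theorem isCompact_polar (hN : IsNorm n N) :
    IsCompact {y : Fin n → ℝ | ∀ x, N x ≤ 1 → |∑ i, y i * x i| ≤ 1} := by
  obtain ⟨C, hC, h⟩ := hN.exists_le_mul_norm
  refine Metric.isCompact_of_isClosed_isBounded ?_ ?_
  · simp only [Set.ofPred_forall]
    refine isClosed_iInter fun x => isClosed_iInter fun _ => isClosed_le ?_ continuous_const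
    fun_prop
  · refine (Metric.isBounded_closedBall (x := (0 : Fin n → ℝ)) (r := C)).subset fun y hy => ?_
    rw [mem_closedBall_zero_iff, pi_norm_le_iff_of_nonneg hC.le]
    intro i
    have hx : N (Pi.single i C⁻¹) ≤ 1 := by
      refine (h _).trans_eq ?_
      rw [Pi.norm_single, Real.norm_of_nonneg (inv_nonneg.2 hC.le), mul_inv_cancel₀ hC.ne']
    have := hy _ hx
    rw [Finset.sum_eq_single i (fun j _ hj => by simp [hj]) (by simp), Pi.single_eq_same, abs_mul,
      abs_of_pos (inv_pos.2 hC), mul_inv_le_iff₀ hC, one_mul] at this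
    exact this

end IsNorm

/-- The volume of the standard cross-polytope. -/
theorem volume_crossPolytope {n : ℕ} (hn : 1 ≤ n) :
    volume {x : Fin n → ℝ | ∑ i, |x i| ≤ 1} = ENNReal.ofReal (2 ^ n / n.factorial) := by
  have : Nonempty (Fin n) := ⟨⟨0, hn⟩⟩
  have h := volume_sum_rpow_le (Fin n) le_rfl 1
  simpa [one_add_one_eq_two, Real.Gamma_nat_eq_factorial] using h

/-- A weak form of Mahler's inequality: the volume of a symmetric convex body times the volume of
its polar is at least `4 ^ n / (n!) ^ 2`. -/
theorem IsNorm.le_volume_ball_mul_volume_polar {n : ℕ} (hn : 1 ≤ n) {N : (Fin n → ℝ) → ℝ}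
    (hN : IsNorm n N) :
    ENNReal.ofReal (2 ^ n / n.factorial) * ENNReal.ofReal (2 ^ n / n.factorial) ≤
      volume {x | N x ≤ 1} *
        volume {y : Fin n → ℝ | ∀ x, N x ≤ 1 → |∑ i, y i * x i| ≤ 1} := by
  have hcomp : IsCompact (Set.univ.pi fun _ : Fin n => {x | N x ≤ 1}) :=
    isCompact_univ_pi fun _ => hN.isCompact_ball
  obtain ⟨C, hC, hNC⟩ := hN.exists_le_mul_norm
  have hdiag : (fun i => Pi.single i C⁻¹) ∈ Set.univ.pi fun _ : Fin n => {x | N x ≤ 1} := by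
    intro i _
    refine (hNC _).trans_eq ?_
    rw [Pi.norm_single, Real.norm_of_nonneg (inv_nonneg.2 hC.le), mul_inv_cancel₀ hC.ne']
  obtain ⟨M, hM, hmax⟩ := hcomp.exists_isMaxOn ⟨_, hdiag⟩
    (f := fun M : Fin n → Fin n → ℝ => |(Matrix.of M).det|)
    (Continuous.matrix_det continuous_id).abs.continuousOn
  have hdet : 0 < |(Matrix.of M).det| := by
    refine lt_of_lt_of_le ?_ (hmax hdiag)
    have : Matrix.of (fun i => Pi.single i C⁻¹) = Matrix.diagonal fun _ : Fin n => C⁻¹ := by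
      ext i j
      simp [Matrix.diagonal_apply, Pi.single_apply, eq_comm]
    simp only [this, Matrix.det_diagonal]
    simp [hC.ne']
  set Q : Matrix (Fin n) (Fin n) ℝ := Matrix.of M with hQ
  have hQrow : ∀ i, N (Q i) ≤ 1 := fun i => hM i (Set.mem_univ i)
  have hdet0 : Q.det ≠ 0 := abs_pos.1 hdet
  have hball : Matrix.toLin' Q.transpose '' {x | ∑ i, |x i| ≤ 1} ⊆ {x | N x ≤ 1} := by
    rintro _ ⟨c, hc, rfl⟩
    rw [Matrix.toLin'_apply, Matrix.mulVec_transpose, Matrix.vecMul_eq_sum]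
    calc N (∑ i, c i • Q i) ≤ ∑ i, |c i| * N (Q i) := hN.map_sum_smul_le _ _ _
      _ ≤ ∑ i, |c i| * 1 := by gcongr with i; exact hQrow i
      _ ≤ 1 := by simpa using hc
  have hpolar : Matrix.toLin' Q ⁻¹' {x | ∑ i, |x i| ≤ 1} ⊆
      {y : Fin n → ℝ | ∀ x, N x ≤ 1 → |∑ i, y i * x i| ≤ 1} := by
    intro y hy x hx
    have hcoef : ∀ i, |Q.transpose.cramer x i| ≤ |Q.det| := by
      intro i
      rw [Matrix.cramer_transpose_apply]
      refine hmax (show Q.updateRow i x ∈ _ from fun j _ => ?_)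
      by_cases hj : j = i
      · subst hj
        simpa using hx
      · simpa [Matrix.updateRow_ne hj] using hQrow j
    have hexp : Q.det * ∑ i, y i * x i = ∑ i, Q.transpose.cramer x i * Q.mulVec y i := by
      have h1 := Matrix.mulVec_cramer Q.transpose x
      rw [Matrix.det_transpose, Matrix.mulVec_transpose] at h1
      have h2 := congrArg (· ⬝ᵥ y) h1
      simp only [smul_dotProduct, smul_eq_mul, ← Matrix.dotProduct_mulVec] at h2
      rw [dotProduct_comm x y] at h2
      exact h2.symm
    rw [← mul_le_mul_iff_right₀ hdet, ← abs_mul, hexp]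
    calc |∑ i, Q.transpose.cramer x i * Q.mulVec y i|
        ≤ ∑ i, |Q.transpose.cramer x i * Q.mulVec y i| := Finset.abs_sum_le_sum_abs _ _
      _ ≤ ∑ i, |Q.det| * |Q.mulVec y i| := by
          gcongr with i
          rw [abs_mul]
          exact mul_le_mul_of_nonneg_right (hcoef i) (abs_nonneg _)
      _ ≤ |Q.det| * 1 := by
          rw [← Finset.mul_sum]
          gcongr
          exact hy
  have h1 := measure_mono (μ := volume) hball
  have h2 := measure_mono (μ := volume) hpolar
  rw [Measure.addHaar_image_linearMap, LinearMap.det_toLin', Matrix.det_transpose,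
    volume_crossPolytope hn] at h1
  rw [Measure.addHaar_preimage_linearMap _ (by rwa [LinearMap.det_toLin']), LinearMap.det_toLin',
    volume_crossPolytope hn] at h2
  refine le_trans (le_of_eq ?_) (mul_le_mul' h1 h2)
  rw [mul_mul_mul_comm, ← ENNReal.ofReal_mul (abs_nonneg _), ← abs_mul, mul_inv_cancel₀ hdet0]
  simp

/-- If `K` is closed under half differences, `S` is a finite set of lattice points in the polar of
`K`, and `T` contains all lattice points of `K`, then `vol K * #S ≤ 6 ^ n * #T`. -/
theorem volume_mul_card_polar_le {n : ℕ} {K : Set (Fin n → ℝ)} (hK : MeasurableSet K)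
    (hsub : ∀ x ∈ K, ∀ x' ∈ K, (2⁻¹ : ℝ) • (x - x') ∈ K) (S T : Finset (Fin n → ℤ))
    (hS : ∀ y ∈ S, ∀ x ∈ K, |∑ i, (y i : ℝ) * x i| ≤ 1)
    (hT : ∀ z : Fin n → ℤ, (fun i => (z i : ℝ)) ∈ K → z ∈ T) :
    volume K * (S.card : ENNReal) ≤ 6 ^ n * (T.card : ENNReal) := by
  have hhalf : ∀ a a' : Fin n → ℝ, a ∈ ((2 : ℝ) • ·) ⁻¹' K → a' ∈ ((2 : ℝ) • ·) ⁻¹' K →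
      (fun i => a i - a' i) ∈ K := by
    intro a a' ha ha'
    have := hsub _ ha _ ha'
    rwa [← smul_sub, smul_smul, inv_mul_cancel₀ two_ne_zero, one_smul] at this
  have h := volume_mul_card_le (A := ((2 : ℝ) • ·) ⁻¹' K) (measurable_const_smul (2 : ℝ) hK) S T
    (fun y hy a ha a' ha' => hS y hy _ (hhalf a a' ha ha'))
    (by
      rintro z ⟨a, ha, a', ha', hz⟩
      apply hT
      simp_rw [hz]
      exact hhalf a a' ha ha')
  rw [Measure.addHaar_preimage_smul _ two_ne_zero] at h
  have h2 : (2 : ENNReal) ^ n * ENNReal.ofReal |((2 : ℝ) ^ Module.finrank ℝ (Fin n → ℝ))⁻¹| = 1 := by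
    rw [Module.finrank_fin_fun, abs_of_pos (by positivity), ENNReal.ofReal_inv_of_pos (by positivity),
      ENNReal.ofReal_pow zero_le_two, ENNReal.ofReal_ofNat]
    exact ENNReal.mul_inv_cancel (by positivity) (by finiteness)
  calc volume K * (S.card : ENNReal)
      = 2 ^ n * (ENNReal.ofReal |((2 : ℝ) ^ Module.finrank ℝ (Fin n → ℝ))⁻¹| * volume K *
          (S.card : ENNReal)) := by
        rw [← mul_assoc, ← mul_assoc, h2, one_mul]
    _ ≤ 2 ^ n * (3 ^ n * (T.card : ENNReal)) := by gcongr
    _ = 6 ^ n * (T.card : ENNReal) := by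
        rw [← mul_assoc, ← mul_pow]
        norm_num

/-- A compact set contains only finitely many lattice points. -/
theorem finite_setOf_intCast_mem {n : ℕ} {K : Set (Fin n → ℝ)} (hK : IsCompact K) :
    {z : Fin n → ℤ | (fun i => (z i : ℝ)) ∈ K}.Finite := by
  obtain ⟨r, hr⟩ := hK.isBounded.subset_closedBall 0
  refine (Set.finite_Icc (fun _ : Fin n => -⌈r⌉) (fun _ => ⌈r⌉)).subset fun z hz => ?_
  have h1 : ∀ i, |z i| ≤ ⌈r⌉ := by
    intro i
    have h2 := (norm_le_pi_norm _ i).trans (mem_closedBall_zero_iff.1 (hr hz))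
    rw [Real.norm_eq_abs] at h2
    exact_mod_cast h2.trans (Int.le_ceil r)
  exact ⟨fun i => (abs_le.1 (h1 i)).1, fun i => (abs_le.1 (h1 i)).2⟩

/-- For every norm `N` on `ℝ^n`:
`−n·log 6 ≤ ĥ⁰(N) − ĥ¹(N) − χ̂(N) ≤ n·log(3/2) + 2·log(n!)`. -/
theorem stmt2 (n : ℕ) (hn : 1 ≤ n) (N : (Fin n → ℝ) → ℝ) (hN : IsNorm n N) :
    -((n : ℝ) * Real.log 6) ≤ h0Hat n N - h1Hat n N - chiHat n N ∧
      h0Hat n N - h1Hat n N - chiHat n N ≤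
        (n : ℝ) * Real.log (3 / 2) + 2 * Real.log (n.factorial) := by
  set B : Set (Fin n → ℝ) := {x | N x ≤ 1} with hB
  set D : Set (Fin n → ℝ) := {y | ∀ x, N x ≤ 1 → |∑ i, y i * x i| ≤ 1} with hD
  have hBc : IsCompact B := hN.isCompact_ball
  have hDc : IsCompact D := hN.isCompact_polar
  have hfin0 := finite_setOf_intCast_mem hBc
  have hfin1 := finite_setOf_intCast_mem hDc
  set T0 := hfin0.toFinset with hT0
  set T1 := hfin1.toFinset with hT1
  have hmem0 : ∀ z, z ∈ T0 ↔ (fun i => (z i : ℝ)) ∈ B := fun z => hfin0.mem_toFinset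
  have hmem1 : ∀ z, z ∈ T1 ↔ (fun i => (z i : ℝ)) ∈ D := fun z => hfin1.mem_toFinset
  have hcard0 : h0Hat n N = Real.log T0.card := by
    rw [hT0, ← Set.ncard_eq_toFinset_card _ hfin0]
    rfl
  have hcard1 : h1Hat n N = Real.log T1.card := by
    rw [hT1, ← Set.ncard_eq_toFinset_card _ hfin1]
    rfl
  have hchi : chiHat n N = Real.log (volume B).toReal := rfl
  have hpos0 : (0 : ℝ) < T0.card := by
    have : (0 : Fin n → ℤ) ∈ T0 := (hmem0 _).2 (by
      have h0 : (fun i => (((0 : Fin n → ℤ) i : ℤ) : ℝ)) = 0 := by ext i; simp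
      rw [h0]
      exact hN.map_zero.le.trans zero_le_one)
    exact_mod_cast Finset.card_pos.2 ⟨_, this⟩
  have hpos1 : (0 : ℝ) < T1.card := by
    have : (0 : Fin n → ℤ) ∈ T1 := (hmem1 _).2 (by simp [hD])
    exact_mod_cast Finset.card_pos.2 ⟨_, this⟩
  have hBsub : ∀ x ∈ B, ∀ x' ∈ B, (2⁻¹ : ℝ) • (x - x') ∈ B := by
    intro x (hx : N x ≤ 1) x' (hx' : N x' ≤ 1)
    change N _ ≤ 1
    have := hN.2.2 x (-x')
    rw [hN.map_neg, ← sub_eq_add_neg] at this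
    rw [hN.2.1, abs_of_pos (by norm_num)]
    linarith
  have hDsub : ∀ y ∈ D, ∀ y' ∈ D, (2⁻¹ : ℝ) • (y - y') ∈ D := by
    intro y hy y' hy' x hx
    have h1 := abs_le.1 (hy x hx)
    have h2 := abs_le.1 (hy' x hx)
    have h3 : ∑ i, ((2⁻¹ : ℝ) • (y - y')) i * x i =
        2⁻¹ * (∑ i, y i * x i - ∑ i, y' i * x i) := by
      rw [← Finset.sum_sub_distrib, Finset.mul_sum]
      refine Finset.sum_congr rfl fun i _ => ?_
      simp only [Pi.smul_apply, Pi.sub_apply, smul_eq_mul]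
      ring
    rw [h3, abs_le]
    constructor <;> linarith
  have key0 := volume_mul_card_polar_le hBc.measurableSet hBsub T1 T0
    (fun y hy x hx => (hmem1 y).1 hy x hx) (fun z hz => (hmem0 z).2 hz)
  have key1 := volume_mul_card_polar_le hDc.measurableSet hDsub T0 T1
    (fun y hy x hx => by
      have := hx _ ((hmem0 y).1 hy)
      simpa only [mul_comm] using this)
    (fun z hz => (hmem1 z).2 hz)
  have key2 := hN.le_volume_ball_mul_volume_polar hn
  have hBtop : volume B ≠ ⊤ := hBc.measure_lt_top.ne
  have hDtop : volume D ≠ ⊤ := hDc.measure_lt_top.ne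
  have r0 : (volume B).toReal * T1.card ≤ 6 ^ n * T0.card := by
    simpa using ENNReal.toReal_mono (by finiteness) key0
  have r1 : (volume D).toReal * T0.card ≤ 6 ^ n * T1.card := by
    simpa using ENNReal.toReal_mono (by finiteness) key1
  have hfac : (0 : ℝ) < n.factorial := by exact_mod_cast n.factorial_pos
  have r2 : (2 ^ n / n.factorial : ℝ) * (2 ^ n / n.factorial) ≤
      (volume B).toReal * (volume D).toReal := by
    have := ENNReal.toReal_mono (ENNReal.mul_ne_top hBtop hDtop) key2
    rwa [ENNReal.toReal_mul, ENNReal.toReal_mul, ENNReal.toReal_ofReal (by positivity)] at this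
  have hprod : 0 < (volume B).toReal * (volume D).toReal := lt_of_lt_of_le (by positivity) r2
  have hBpos : 0 < (volume B).toReal := pos_of_mul_pos_left hprod ENNReal.toReal_nonneg
  have hDpos : 0 < (volume D).toReal := pos_of_mul_pos_right hprod ENNReal.toReal_nonneg
  have l0 := Real.log_le_log (by positivity) r0
  have l1 := Real.log_le_log (by positivity) r1
  have l2 := Real.log_le_log (by positivity) r2
  have h6 : (6 : ℝ) ^ n ≠ 0 := by positivity
  have h2 : (2 : ℝ) ^ n ≠ 0 := by positivity
  have hq : (2 ^ n / n.factorial : ℝ) ≠ 0 := by positivity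
  rw [Real.log_mul hBpos.ne' hpos1.ne', Real.log_mul h6 hpos0.ne', Real.log_pow] at l0
  rw [Real.log_mul hDpos.ne' hpos0.ne', Real.log_mul h6 hpos1.ne', Real.log_pow] at l1
  rw [Real.log_mul hq hq, Real.log_mul hBpos.ne' hDpos.ne', Real.log_div h2 hfac.ne',
    Real.log_pow] at l2
  have h32 : (n : ℝ) * Real.log (3 / 2) = n * Real.log 6 - 2 * (n * Real.log 2) := by
    have : (3 / 2 : ℝ) = 6 / 2 ^ 2 := by norm_num
    rw [this, Real.log_div (by norm_num) (by norm_num), Real.log_pow]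
    push_cast
    ring
  rw [hcard0, hcard1, hchi, h32]
  constructor <;> linarith
end

section
/- Let V be a finite-dimensional real normed vector space, Λ ⊆ V a lattice (a discrete additive subgroup that spans V over ℝ), and W ⊆ V a linear subspace that is spanned over ℝ by Λ ∩ W. Equip V/W with the quotient norm ‖v̄‖ = inf{‖v + w‖ : w ∈ W}, and let Λ'' be the image of Λ in V/W. Then log #{x ∈ Λ : ‖x‖ ≤ 1} ≤ log #{x ∈ Λ ∩ W : ‖x‖ ≤ 1} + log #{z ∈ Λ'' : ‖z‖ ≤ 1} + (log 18)·r' + 2·log(r'!), where r' = dim_ℝ W. -/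
/-- Every finite subset of a seminormed group contains a `1`-separated subset which is a
`1`-net for it. -/
theorem Finset.exists_separated_net {E : Type*} [SeminormedAddCommGroup E] (S : Finset E) :
    ∃ T ⊆ S, (∀ c ∈ T, ∀ d ∈ T, c ≠ d → 1 ≤ ‖c - d‖) ∧ ∀ x ∈ S, ∃ c ∈ T, ‖x - c‖ ≤ 1 := by
  classical
  induction S using Finset.induction_on with
  | empty => exact ⟨∅, by simp⟩
  | insert a S _ ih =>
    obtain ⟨T, hTS, hsep, hnet⟩ := ih
    by_cases h : ∃ c ∈ T, ‖a - c‖ ≤ 1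
    · refine ⟨T, hTS.trans (Finset.subset_insert _ _), hsep, fun x hx => ?_⟩
      rcases Finset.mem_insert.1 hx with rfl | hx
      exacts [h, hnet x hx]
    · push Not at h
      refine ⟨insert a T, Finset.insert_subset_insert a hTS, fun c hc d hd hcd => ?_,
        fun x hx => ?_⟩
      · rcases Finset.mem_insert.1 hc with rfl | hcT <;>
          rcases Finset.mem_insert.1 hd with rfl | hdT
        · exact absurd rfl hcd
        · exact (h d hdT).le
        · rw [norm_sub_rev]
          exact (h c hcT).le
        · exact hsep c hcT d hdT hcd
      · rcases Finset.mem_insert.1 hx with rfl | hx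
        · exact ⟨x, Finset.mem_insert_self _ _, by simp⟩
        · obtain ⟨c, hc, hxc⟩ := hnet x hx
          exact ⟨c, Finset.mem_insert_of_mem hc, hxc⟩

/-- A finite set in the ball of radius `2` whose differences of norm at most `1` lie in `B` has
at most `5 ^ finrank ℝ E * #B` elements. -/
theorem Finset.card_le_five_pow_mul_card {E : Type*} [NormedAddCommGroup E] [NormedSpace ℝ E]
    [FiniteDimensional ℝ E] (S B : Finset E) (hS : ∀ x ∈ S, ‖x‖ ≤ 2)
    (hB : ∀ x ∈ S, ∀ y ∈ S, ‖x - y‖ ≤ 1 → x - y ∈ B) :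
    S.card ≤ 5 ^ Module.finrank ℝ E * B.card := by
  classical
  obtain ⟨T, hTS, hsep, hnet⟩ := S.exists_separated_net
  have hT : T.card ≤ 5 ^ Module.finrank ℝ E :=
    Besicovitch.card_le_of_separated T (fun c hc => hS c (hTS hc)) hsep
  have hsub : S ⊆ (T ×ˢ B).image fun p => p.1 + p.2 := fun x hx => by
    obtain ⟨c, hc, hxc⟩ := hnet x hx
    exact Finset.mem_image.2 ⟨(c, x - c),
      Finset.mem_product.2 ⟨hc, hB x hx c (hTS hc) hxc⟩, by simp⟩
  calc S.card ≤ (T ×ˢ B).card := (Finset.card_le_card hsub).trans Finset.card_image_le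
    _ = T.card * B.card := Finset.card_product _ _
    _ ≤ _ := Nat.mul_le_mul_right _ hT

/-- A discrete subgroup of a finite-dimensional space has finitely many points in each ball. -/
theorem AddSubgroup.finite_norm_le_of_discrete {V : Type*} [NormedAddCommGroup V]
    [NormedSpace ℝ V] [FiniteDimensional ℝ V] (Λ : AddSubgroup V) [DiscreteTopology Λ] (R : ℝ) :
    {x : V | x ∈ Λ ∧ ‖x‖ ≤ R}.Finite := by
  have : ProperSpace V := FiniteDimensional.proper ℝ V
  have hcl : IsClosed (Λ : Set V) := AddSubgroup.isClosed_of_discrete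
  have hd : IsDiscrete (Λ : Set V) := ⟨inferInstance⟩
  refine (Metric.finite_isBounded_inter_isClosed hd
    (Metric.isBounded_closedBall (x := (0 : V)) (r := R)) hcl).subset fun x hx => ?_
  exact ⟨by simpa using hx.2, hx.1⟩

/-- If `Λ ∩ W` spans `W`, then every element of `W` is within a fixed distance of `Λ ∩ W`. -/
theorem Submodule.exists_bound_sub_mem_of_span_inter_eq {V : Type*} [NormedAddCommGroup V]
    [NormedSpace ℝ V] [FiniteDimensional ℝ V] (Λ : AddSubgroup V) (W : Submodule ℝ V)
    (hW : Submodule.span ℝ ((Λ : Set V) ∩ (W : Set V)) = W) :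
    ∃ R : ℝ, ∀ w ∈ W, ∃ u ∈ Λ, u ∈ W ∧ ‖w - u‖ ≤ R := by
  obtain ⟨t, ht, hspan⟩ := (Submodule.fg_span_iff_fg_span_finset_subset (R := ℝ)
    ((Λ : Set V) ∩ (W : Set V))).1 (IsNoetherian.noetherian _)
  rw [hW] at hspan
  refine ⟨∑ v ∈ t, ‖v‖, fun w hw => ?_⟩
  rw [hspan] at hw
  obtain ⟨f, -, rfl⟩ := Submodule.mem_span_finset.1 hw
  refine ⟨∑ v ∈ t, ⌊f v⌋ • v, sum_mem fun v hv => zsmul_mem (ht hv).1 _,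
    sum_mem fun v hv => zsmul_mem (ht hv).2 _, ?_⟩
  rw [← Finset.sum_sub_distrib]
  refine norm_sum_le_of_le _ fun v _ => ?_
  rw [← Int.cast_smul_eq_zsmul ℝ, ← sub_smul, norm_smul, Int.self_sub_floor,
    Real.norm_of_nonneg (Int.fract_nonneg _)]
  exact mul_le_of_le_one_left (norm_nonneg _) (Int.fract_lt_one _).le

/-- If `Λ` is discrete and `Λ ∩ W` spans `W`, the image of `Λ` in `V ⧸ W` has finitely many
points in each ball. -/
theorem AddSubgroup.finite_map_mk_norm_le {V : Type*} [NormedAddCommGroup V]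
    [NormedSpace ℝ V] [FiniteDimensional ℝ V] (Λ : AddSubgroup V) [DiscreteTopology Λ]
    (W : Submodule ℝ V) (hW : Submodule.span ℝ ((Λ : Set V) ∩ (W : Set V)) = W) (r : ℝ) :
    {z | z ∈ Λ.map (QuotientAddGroup.mk' W.toAddSubgroup) ∧
      ‖(z : V ⧸ W.toAddSubgroup)‖ ≤ r}.Finite := by
  obtain ⟨R, hR⟩ := W.exists_bound_sub_mem_of_span_inter_eq Λ hW
  refine ((Λ.finite_norm_le_of_discrete (r + 1 + R)).image
    (QuotientAddGroup.mk' W.toAddSubgroup)).subset ?_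
  rintro z ⟨⟨x, hx, rfl⟩, hz⟩
  obtain ⟨v, hv, hvn⟩ := QuotientAddGroup.exists_norm_mk_lt
    (QuotientAddGroup.mk' W.toAddSubgroup x) one_pos
  have hvx : -v + x ∈ W := QuotientAddGroup.eq.1 hv
  obtain ⟨u, hu, huW, hun⟩ := hR _ hvx
  refine ⟨x - u, ⟨Λ.sub_mem hx hu, ?_⟩, ?_⟩
  · calc ‖x - u‖ = ‖v + (-v + x - u)‖ := by congr 1; abel
      _ ≤ ‖v‖ + ‖-v + x - u‖ := norm_add_le _ _
      _ ≤ r + 1 + R := by linarith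
  · refine QuotientAddGroup.eq.2 ?_
    have : -(x - u) + x = u := by abel
    rw [this]
    exact huW

/-- The number of lattice points in the unit ball of `V` is bounded by the product of those of
`W` and `V ⧸ W`, up to a factor `5 ^ finrank ℝ W`. -/
theorem AddSubgroup.card_norm_le_one_le {V : Type*} [NormedAddCommGroup V]
    [NormedSpace ℝ V] [FiniteDimensional ℝ V] (Λ : AddSubgroup V) (W : Submodule ℝ V)
    [Finite {x : Λ // ‖(x : V)‖ ≤ 1}]
    [Finite {x : Λ // (x : V) ∈ W ∧ ‖(x : V)‖ ≤ 1}]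
    [Finite {z : Λ.map (QuotientAddGroup.mk' W.toAddSubgroup) //
      ‖(z : V ⧸ W.toAddSubgroup)‖ ≤ 1}] :
    Nat.card {x : Λ // ‖(x : V)‖ ≤ 1} ≤
      5 ^ Module.finrank ℝ W * Nat.card {x : Λ // (x : V) ∈ W ∧ ‖(x : V)‖ ≤ 1} *
        Nat.card {z : Λ.map (QuotientAddGroup.mk' W.toAddSubgroup) //
          ‖(z : V ⧸ W.toAddSubgroup)‖ ≤ 1} := by
  classical
  have := Fintype.ofFinite {x : Λ // ‖(x : V)‖ ≤ 1}
  have := Fintype.ofFinite {x : Λ // (x : V) ∈ W ∧ ‖(x : V)‖ ≤ 1}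
  have := Fintype.ofFinite {z : Λ.map (QuotientAddGroup.mk' W.toAddSubgroup) //
    ‖(z : V ⧸ W.toAddSubgroup)‖ ≤ 1}
  simp only [Nat.card_eq_fintype_card]
  let f : {x : Λ // ‖(x : V)‖ ≤ 1} → {z : Λ.map (QuotientAddGroup.mk' W.toAddSubgroup) //
      ‖(z : V ⧸ W.toAddSubgroup)‖ ≤ 1} := fun x =>
    ⟨⟨QuotientAddGroup.mk' W.toAddSubgroup x.1, AddSubgroup.mem_map_of_mem _ x.1.2⟩,
      (QuotientAddGroup.norm_mk_le_norm).trans x.2⟩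
  let B : Finset W := Finset.univ.image
    fun x : {x : Λ // (x : V) ∈ W ∧ ‖(x : V)‖ ≤ 1} => ⟨x.1, x.2.1⟩
  refine Finset.card_le_mul_card_image_of_maps_to (f := f) (fun _ _ => Finset.mem_univ _) _
    fun z _ => ?_
  rcases Finset.eq_empty_or_nonempty (Finset.univ.filter fun x => f x = z) with h | ⟨y, hy⟩
  · simp [h]
  have hyz : f y = z := (Finset.mem_filter.1 hy).2
  have hmem : ∀ x, f x = z → ((x.1 : V) - y.1) ∈ W := fun x hx => by
    have h : QuotientAddGroup.mk' W.toAddSubgroup (y.1 : V) = QuotientAddGroup.mk' _ (x.1 : V) :=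
      congrArg (fun z => z.1.1) (hyz.trans hx.symm)
    rw [sub_eq_neg_add]
    exact QuotientAddGroup.eq.1 h
  let g : {x // x ∈ Finset.univ.filter fun x => f x = z} → W := fun x =>
    ⟨(x.1.1 : V) - y.1, hmem x.1 (Finset.mem_filter.1 x.2).2⟩
  have hg : Function.Injective g := fun a b hab => by
    have h : (a.1.1 : V) - y.1 = b.1.1 - y.1 := congrArg Subtype.val hab
    exact Subtype.ext (Subtype.ext (Subtype.ext (sub_left_injective h)))
  have key := Finset.card_le_five_pow_mul_card (Finset.univ.image g) B ?_ ?_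
  · rw [Finset.card_image_of_injective _ hg, Finset.card_univ, Fintype.card_coe] at key
    exact key.trans (Nat.mul_le_mul_left _ Finset.card_image_le)
  · intro x hx
    obtain ⟨a, -, rfl⟩ := Finset.mem_image.1 hx
    calc ‖g a‖ = ‖(a.1.1 : V) - y.1‖ := rfl
      _ ≤ ‖(a.1.1 : V)‖ + ‖(y.1 : V)‖ := norm_sub_le _ _
      _ ≤ 2 := by linarith [a.1.2, y.2]
  · intro x hx x' hx' hn
    obtain ⟨a, -, rfl⟩ := Finset.mem_image.1 hx
    obtain ⟨b, -, rfl⟩ := Finset.mem_image.1 hx'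
    have hab : ((g a - g b : W) : V) = ((a.1.1 - b.1.1 : Λ) : V) := by
      simp [g]
    refine Finset.mem_image.2 ⟨⟨a.1.1 - b.1.1, ?_, ?_⟩, Finset.mem_univ _, Subtype.ext hab.symm⟩
    · rw [← hab]
      exact (g a - g b).2
    · rw [← hab]
      exact hn


/-- Exact-sequence inequality for counting small lattice points: for a lattice `Λ` in a
finite-dimensional real normed space `V` and a subspace `W` spanned by `Λ ∩ W`,
`log #{x ∈ Λ : ‖x‖ ≤ 1} ≤ log #{x ∈ Λ ∩ W : ‖x‖ ≤ 1} + log #{z ∈ Λ'' : ‖z‖ ≤ 1}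
  + (log 18)·r' + 2·log(r'!)`,
where `Λ''` is the image of `Λ` in `V/W` with the quotient norm and `r' = dim W`. -/
theorem stmt5 (V : Type*) [NormedAddCommGroup V] [NormedSpace ℝ V]
    [FiniteDimensional ℝ V]
    (Λ : AddSubgroup V) (hdisc : DiscreteTopology Λ)
    (hspan : Submodule.span ℝ (Λ : Set V) = ⊤)
    (W : Submodule ℝ V)
    (hW : Submodule.span ℝ ((Λ : Set V) ∩ (W : Set V)) = W) :
    Real.log (Nat.card {x : Λ // ‖(x : V)‖ ≤ 1}) ≤
      Real.log (Nat.card {x : Λ // (x : V) ∈ W ∧ ‖(x : V)‖ ≤ 1}) +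
        Real.log (Nat.card
          {z : Λ.map (QuotientAddGroup.mk' W.toAddSubgroup) //
            ‖(z : V ⧸ W.toAddSubgroup)‖ ≤ 1}) +
        Real.log 18 * (Module.finrank ℝ W) +
        2 * Real.log (Nat.factorial (Module.finrank ℝ W)) := by
  have hinj : Function.Injective fun x : Λ => (x : V) := Subtype.val_injective
  have hfinA : Finite {x : Λ // ‖(x : V)‖ ≤ 1} :=
    ((Λ.finite_norm_le_of_discrete 1).preimage hinj.injOn |>.subset fun x hx => ⟨x.2, hx⟩ :
      {x : Λ | ‖(x : V)‖ ≤ 1}.Finite)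
  have hfinB : Finite {x : Λ // (x : V) ∈ W ∧ ‖(x : V)‖ ≤ 1} :=
    ((Λ.finite_norm_le_of_discrete 1).preimage hinj.injOn |>.subset fun x hx => ⟨x.2, hx.2⟩ :
      {x : Λ | (x : V) ∈ W ∧ ‖(x : V)‖ ≤ 1}.Finite)
  have hfinC : Finite {z : Λ.map (QuotientAddGroup.mk' W.toAddSubgroup) //
      ‖(z : V ⧸ W.toAddSubgroup)‖ ≤ 1} :=
    ((Λ.finite_map_mk_norm_le W hW 1).preimage Subtype.val_injective.injOn |>.subset
      fun z hz => ⟨z.2, hz⟩ : {z : Λ.map (QuotientAddGroup.mk' W.toAddSubgroup) |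
        ‖(z : V ⧸ W.toAddSubgroup)‖ ≤ 1}.Finite)
  have hneA : Nonempty {x : Λ // ‖(x : V)‖ ≤ 1} := ⟨0, by simp⟩
  have hneB : Nonempty {x : Λ // (x : V) ∈ W ∧ ‖(x : V)‖ ≤ 1} := ⟨0, by simp⟩
  have hneC : Nonempty {z : Λ.map (QuotientAddGroup.mk' W.toAddSubgroup) //
      ‖(z : V ⧸ W.toAddSubgroup)‖ ≤ 1} := ⟨0, by simp⟩
  have hcard := Λ.card_norm_le_one_le W
  have hA := Nat.card_pos (α := {x : Λ // ‖(x : V)‖ ≤ 1})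
  have hB := Nat.card_pos (α := {x : Λ // (x : V) ∈ W ∧ ‖(x : V)‖ ≤ 1})
  have hC := Nat.card_pos (α := {z : Λ.map (QuotientAddGroup.mk' W.toAddSubgroup) //
    ‖(z : V ⧸ W.toAddSubgroup)‖ ≤ 1})
  generalize Nat.card {x : Λ // ‖(x : V)‖ ≤ 1} = a at *
  generalize Nat.card {x : Λ // (x : V) ∈ W ∧ ‖(x : V)‖ ≤ 1} = b at *
  generalize Nat.card {z : Λ.map (QuotientAddGroup.mk' W.toAddSubgroup) //
    ‖(z : V ⧸ W.toAddSubgroup)‖ ≤ 1} = c at *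
  generalize Module.finrank ℝ W = r at *
  have ha : (0 : ℝ) < a := by exact_mod_cast hA
  have hb : (b : ℝ) ≠ 0 := by exact_mod_cast hB.ne'
  have hc : (c : ℝ) ≠ 0 := by exact_mod_cast hC.ne'
  have hlog : Real.log a ≤ Real.log (5 ^ r * b * c) :=
    Real.log_le_log ha (by exact_mod_cast hcard)
  rw [Real.log_mul (by positivity) hc, Real.log_mul (by positivity) hb, Real.log_pow] at hlog
  have h5 : Real.log 5 * r ≤ Real.log 18 * r :=
    mul_le_mul_of_nonneg_right (Real.log_le_log (by norm_num) (by norm_num)) r.cast_nonneg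
  have hfact : 0 ≤ Real.log r.factorial := Real.log_natCast_nonneg _
  linarith
end

section
/- Let K ⊆ ℝ^n be a bounded convex centrally symmetric body with 0 in its interior, and suppose f is a real number with 0 < f ≤ V(K)·V(K*). Then 6^{−n} ≤ M(K) / (M(K*)·V(K)) ≤ 6^n / f. -/
open MeasureTheory

/-- `M(K)`: the number of integer lattice points in `K ⊆ ℝ^n`. -/
noncomputable def latticeCount (n : ℕ) (K : Set (Fin n → ℝ)) : ℕ :=
  Nat.card {x : Fin n → ℤ // (fun i => (x i : ℝ)) ∈ K}

/-- The polar body `K* = {x : |⟨x,y⟩| ≤ 1 for all y ∈ K}`. -/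
def polarBody (n : ℕ) (K : Set (Fin n → ℝ)) : Set (Fin n → ℝ) :=
  {x | ∀ y ∈ K, |∑ i, x i * y i| ≤ 1}

lemma finite_lattice_points {n : ℕ} {K : Set (Fin n → ℝ)} (hK : Bornology.IsBounded K) :
    {x : Fin n → ℤ | (fun i => (x i : ℝ)) ∈ K}.Finite := by
  obtain ⟨R, hR⟩ := hK.exists_norm_le
  refine (Set.finite_Icc (fun _ : Fin n => -⌈R⌉) (fun _ => ⌈R⌉)).subset fun x hx => ?_
  have h (i : Fin n) : |(x i : ℝ)| ≤ ⌈R⌉ :=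
    ((norm_le_pi_norm (fun i => (x i : ℝ)) i).trans (hR _ hx)).trans (Int.le_ceil R)
  exact ⟨fun i => by exact_mod_cast (abs_le.1 (h i)).1, fun i => by exact_mod_cast (abs_le.1 (h i)).2⟩

lemma latticeCount_le_of_injective {m n : ℕ} {K : Set (Fin m → ℝ)} {L : Set (Fin n → ℝ)}
    (hL : Bornology.IsBounded L) (g : (Fin m → ℤ) → (Fin n → ℤ)) (hg : Function.Injective g)
    (hKL : ∀ x : Fin m → ℤ, (fun i => (x i : ℝ)) ∈ K → (fun i => (g x i : ℝ)) ∈ L) :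
    latticeCount m K ≤ latticeCount n L := by
  have : Finite {x : Fin n → ℤ // (fun i => (x i : ℝ)) ∈ L} :=
    (finite_lattice_points hL).to_subtype
  exact Nat.card_le_card_of_injective
    (β := {x : Fin n → ℤ // (fun i => (x i : ℝ)) ∈ L}) (fun x => ⟨g x.1, hKL _ x.2⟩)
    fun x y h => Subtype.ext (hg (congrArg Subtype.val h))

/-- Blichfeldt's principle. -/
lemma volume_le_latticeCount {n : ℕ} {K B : Set (Fin n → ℝ)} (hK : Bornology.IsBounded K)
    (hB : MeasurableSet B) (hBK : ∀ a ∈ B, ∀ b ∈ B, a - b ∈ K) :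
    volume B ≤ latticeCount n K := by
  set b := Pi.basisFun ℝ (Fin n)
  have hF := ZSpan.isAddFundamentalDomain b volume
  have hcoord (g : Submodule.span ℤ (Set.range b)) : ∃ z : Fin n → ℤ, (fun i => (z i : ℝ)) = g := by
    have h := (b.mem_span_iff_repr_mem ℤ g.1).1 g.2
    choose z hz using h
    exact ⟨z, funext fun i => by simpa [b] using hz i⟩
  choose z hz using hcoord
  have hinj : Function.Injective z := fun g g' h => Subtype.ext (by rw [← hz g, ← hz g', h])
  have : Countable (Submodule.span ℤ (Set.range b)) := hinj.countable
  have hfib (x : Fin n → ℝ) :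
      ∑' g : Submodule.span ℤ (Set.range b), B.indicator (1 : (Fin n → ℝ) → ENNReal) (g +ᵥ x)
        ≤ latticeCount n K := by
    set S : Set (Submodule.span ℤ (Set.range b)) := {g | g +ᵥ x ∈ B}
    have hS : ∑' g : Submodule.span ℤ (Set.range b),
        B.indicator (1 : (Fin n → ℝ) → ENNReal) (g +ᵥ x) = (S.encard : ENNReal) := by
      rw [← ENNReal.tsum_set_one, tsum_subtype S (fun _ => (1 : ENNReal))]
      rfl
    rw [hS]
    obtain hS0 | ⟨g₀, hg₀⟩ := S.eq_empty_or_nonempty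
    · simp [hS0]
    have hfin := finite_lattice_points hK
    have hle : S.encard ≤ {x : Fin n → ℤ | (fun i => (x i : ℝ)) ∈ K}.encard := by
      refine Set.encard_le_encard_of_injOn (f := fun g => z g - z g₀) (fun g hg => ?_)
        fun g _ g' _ h => hinj (sub_left_injective h)
      have := hBK _ hg _ hg₀
      have e : (g +ᵥ x) - (g₀ +ᵥ x) = fun i => (((z g - z g₀) i : ℤ) : ℝ) := by
        funext i
        have h1 := congrFun (hz g) i
        have h2 := congrFun (hz g₀) i
        simp only [Submodule.vadd_def, Pi.sub_apply, vadd_eq_add, Pi.add_apply, Int.cast_sub, h1, h2]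
        ring
      rwa [e] at this
    have hc : {x : Fin n → ℤ | (fun i => (x i : ℝ)) ∈ K}.encard = (latticeCount n K : ℕ∞) := by
      rw [← hfin.cast_ncard_eq]; rfl
    rw [hc] at hle
    exact_mod_cast hle
  have : VAddInvariantMeasure (Submodule.span ℤ (Set.range b)) (Fin n → ℝ) volume :=
    inferInstanceAs <| VAddInvariantMeasure (Submodule.span ℤ (Set.range b)).toAddSubgroup _ _
  have hmeas (g : Submodule.span ℤ (Set.range b)) :
      Measurable fun x => B.indicator (1 : (Fin n → ℝ) → ENNReal) (g +ᵥ x) :=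
    (measurable_one.indicator hB).comp (measurable_const_vadd g)
  calc volume B = ∫⁻ x, B.indicator 1 x := (lintegral_indicator_one hB).symm
    _ = ∑' g : Submodule.span ℤ (Set.range b),
          ∫⁻ x in ZSpan.fundamentalDomain b, B.indicator 1 (g +ᵥ x) := hF.lintegral_eq_tsum'' _
    _ = ∫⁻ x in ZSpan.fundamentalDomain b, ∑' g : Submodule.span ℤ (Set.range b),
          B.indicator 1 (g +ᵥ x) := (lintegral_tsum fun g => (hmeas g).aemeasurable).symm
    _ ≤ ∫⁻ _ in ZSpan.fundamentalDomain b, (latticeCount n K : ENNReal) := lintegral_mono hfib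
    _ = latticeCount n K := by
      rw [setLIntegral_const, ZSpan.fundamentalDomain_pi_basisFun, volume_pi_pi]
      simp

lemma isBounded_polarBody {n : ℕ} {K : Set (Fin n → ℝ)} (hK0 : (0 : Fin n → ℝ) ∈ interior K) :
    Bornology.IsBounded (polarBody n K) := by
  obtain ⟨ε, hε, hεK⟩ := Metric.mem_nhds_iff.1 (mem_interior_iff_mem_nhds.1 hK0)
  refine isBounded_iff_forall_norm_le.2 ⟨2 / ε, fun z hz => ?_⟩
  refine (pi_norm_le_iff_of_nonneg (by positivity)).2 fun i => ?_
  have hmem : Pi.single i (ε / 2) ∈ K := hεK (by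
    rw [mem_ball_zero_iff, Pi.norm_single, Real.norm_of_nonneg (by positivity)]; linarith)
  have h := hz _ hmem
  simp only [Pi.single_apply, mul_ite, mul_zero, Finset.sum_ite_eq', Finset.mem_univ, if_true] at h
  rw [abs_mul, abs_of_pos (half_pos hε)] at h
  rw [Real.norm_eq_abs, le_div_iff₀ hε]
  linarith

lemma zero_mem_interior_polarBody {n : ℕ} {K : Set (Fin n → ℝ)} (hK : Bornology.IsBounded K) :
    (0 : Fin n → ℝ) ∈ interior (polarBody n K) := by
  obtain ⟨R, hR0, hR⟩ := hK.exists_pos_norm_le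
  rw [mem_interior_iff_mem_nhds, Metric.mem_nhds_iff]
  refine ⟨1 / (n * R + 1), by positivity, fun x hx y hy => ?_⟩
  rw [mem_ball_zero_iff, lt_div_iff₀ (by positivity)] at hx
  calc |∑ i, x i * y i| ≤ ∑ i, |x i * y i| := Finset.abs_sum_le_sum_abs _ _
    _ ≤ ∑ _i : Fin n, ‖x‖ * R := by
      refine Finset.sum_le_sum fun i _ => ?_
      rw [abs_mul]
      exact mul_le_mul (norm_le_pi_norm x i) ((norm_le_pi_norm y i).trans (hR y hy))
        (abs_nonneg _) (norm_nonneg _)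
    _ = ‖x‖ * (n * R) := by simp; ring
    _ ≤ 1 := by nlinarith [norm_nonneg x]

lemma latticeCount_pos {n : ℕ} {K : Set (Fin n → ℝ)} (hK : Bornology.IsBounded K)
    (h0 : (0 : Fin n → ℝ) ∈ K) : 0 < latticeCount n K := by
  have : Finite {x : Fin n → ℤ // (fun i => (x i : ℝ)) ∈ K} :=
    (finite_lattice_points hK).to_subtype
  have : Nonempty {x : Fin n → ℤ // (fun i => (x i : ℝ)) ∈ K} :=
    ⟨0, by simpa [← Pi.zero_def] using h0⟩
  exact Nat.card_pos (α := {x : Fin n → ℤ // (fun i => (x i : ℝ)) ∈ K})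

lemma zero_mem_polarBody {n : ℕ} (K : Set (Fin n → ℝ)) : 0 ∈ polarBody n K := fun _ _ => by simp

lemma isClosed_polarBody {n : ℕ} (K : Set (Fin n → ℝ)) : IsClosed (polarBody n K) := by
  have : polarBody n K = ⋂ y ∈ K, {x | |∑ i, x i * y i| ≤ 1} := by
    ext x; simp [polarBody]
  rw [this]
  exact isClosed_biInter fun y _ => isClosed_le (by fun_prop) continuous_const

lemma half_sub_mem_polarBody {n : ℕ} {K : Set (Fin n → ℝ)} {a b : Fin n → ℝ}
    (ha : a ∈ polarBody n K) (hb : b ∈ polarBody n K) : (1 / 2 : ℝ) • (a - b) ∈ polarBody n K := by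
  intro y hy
  have h1 := abs_le.1 (ha y hy)
  have h2 := abs_le.1 (hb y hy)
  have e : ∑ i, ((1 / 2 : ℝ) • (a - b)) i * y i = 1 / 2 * (∑ i, a i * y i - ∑ i, b i * y i) := by
    rw [← Finset.sum_sub_distrib, Finset.mul_sum]
    exact Finset.sum_congr rfl fun i _ => by simp; ring
  rw [e, abs_le]
  constructor <;> linarith

lemma cast_cons {n : ℕ} (s : ℤ) (x : Fin n → ℤ) :
    (fun i => ((Fin.cons s x : Fin (n + 1) → ℤ) i : ℝ)) =
      (Fin.cons (s : ℝ) (fun i => (x i : ℝ)) : Fin (n + 1) → ℝ) := by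
  funext i
  refine Fin.cases ?_ (fun j => ?_) i <;> simp

lemma volume_eq_lintegral_cons {n : ℕ} {A : Set (Fin (n + 1) → ℝ)} (hA : MeasurableSet A) :
    volume A = ∫⁻ t : ℝ, volume {x : Fin n → ℝ | (Fin.cons t x : Fin (n + 1) → ℝ) ∈ A} := by
  have h := (volume_preserving_piFinSuccAbove (fun _ : Fin (n + 1) => ℝ) 0).symm
  rw [← h.measure_preimage hA.nullMeasurableSet, Measure.volume_eq_prod,
    Measure.prod_apply (h.measurable hA)]
  refine lintegral_congr fun t => congrArg volume (Set.ext fun x => ?_)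
  simp [MeasurableEquiv.piFinSuccAbove, Fin.consEquiv]

lemma card_le_floor_add_one (S : Finset ℤ) {r : ℝ} (hr : 0 ≤ r)
    (hS : ∀ s ∈ S, ∀ t ∈ S, |(s : ℝ) - t| ≤ r) : S.card ≤ ⌊r⌋₊ + 1 := by
  obtain rfl | hne := S.eq_empty_or_nonempty
  · simp
  have hsub : S ⊆ Finset.Icc (S.min' hne) (S.min' hne + ⌊r⌋₊) := fun s hs => by
    have h1 := S.min'_le s hs
    have h2 := (le_abs_self _).trans (hS s hs _ (S.min'_mem hne))
    have h3 : s - S.min' hne ≤ ⌊r⌋ := Int.le_floor.2 (by push_cast; exact h2)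
    rw [← Int.natCast_floor_eq_floor hr] at h3
    exact Finset.mem_Icc.2 ⟨h1, by omega⟩
  refine (Finset.card_le_card hsub).trans ?_
  rw [Int.card_Icc]
  omega

/-- If points of the polar body differing only in the `0`-th coordinate differ by at most `r` there,
then its lattice points are controlled by those of the polar of the slice `x 0 = 0` of `K`. -/
lemma latticeCount_polarBody_le {n : ℕ} {K : Set (Fin (n + 1) → ℝ)}
    (hP : Bornology.IsBounded (polarBody (n + 1) K))
    (hQ : Bornology.IsBounded (polarBody n {x | (Fin.cons 0 x : Fin (n + 1) → ℝ) ∈ K}))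
    {r : ℝ} (hr : 0 ≤ r)
    (hd : ∀ a ∈ polarBody (n + 1) K, ∀ b ∈ polarBody (n + 1) K,
      Fin.tail a = Fin.tail b → |a 0 - b 0| ≤ r) :
    latticeCount (n + 1) (polarBody (n + 1) K) ≤
      (⌊r⌋₊ + 1) * latticeCount n (polarBody n {x | (Fin.cons 0 x : Fin (n + 1) → ℝ) ∈ K}) := by
  classical
  set K₀ : Set (Fin n → ℝ) := {x | (Fin.cons 0 x : Fin (n + 1) → ℝ) ∈ K}
  have hPf := finite_lattice_points hP
  have hQf := finite_lattice_points hQ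
  have h1 : latticeCount (n + 1) (polarBody (n + 1) K) = hPf.toFinset.card :=
    Set.ncard_eq_toFinset_card _ hPf
  have h2 : latticeCount n (polarBody n K₀) = hQf.toFinset.card :=
    Set.ncard_eq_toFinset_card _ hQf
  rw [h1, h2]
  refine Finset.card_le_mul_card_image_of_maps_to (f := fun z : Fin (n + 1) → ℤ => Fin.tail z)
    (fun z hz => ?_) _ fun w _ => ?_
  · rw [Set.Finite.mem_toFinset] at hz ⊢
    intro x hx
    have := hz _ hx
    simpa [Fin.sum_univ_succ, Fin.tail] using this
  · rw [← Finset.card_image_of_injOn (f := fun z : Fin (n + 1) → ℤ => z 0)]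
    · refine card_le_floor_add_one _ hr fun s hs t ht => ?_
      simp only [Finset.mem_image, Finset.mem_filter, Set.Finite.mem_toFinset] at hs ht
      obtain ⟨a, ⟨ha, haw⟩, rfl⟩ := hs
      obtain ⟨b, ⟨hb, hbw⟩, rfl⟩ := ht
      refine hd _ ha _ hb (funext fun i => ?_)
      have := congrFun (haw.trans hbw.symm) i
      simp only [Fin.tail] at this ⊢
      rw [this]
    · intro a ha b hb hab
      simp only [Finset.coe_filter, Set.mem_ofPred_eq] at ha hb
      rw [← Fin.cons_self_tail a, ← Fin.cons_self_tail b, ha.2, hb.2]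
      exact congrArg (fun s => (Fin.cons s w : Fin (n + 1) → ℤ)) hab

/-- The bound `vol(A) M(K*) ≤ 6^n M(K)` whenever `(A - A) / 2 ⊆ K`. Allowing an auxiliary set
`A` in place of `K` avoids any appeal to the Brunn-Minkowski inequality for the slices. -/
def VolumeMulPolarBound (n : ℕ) : Prop :=
  ∀ K A : Set (Fin n → ℝ), Bornology.IsBounded K → (0 : Fin n → ℝ) ∈ interior K →
    MeasurableSet A → (∀ a ∈ A, ∀ b ∈ A, (1 / 2 : ℝ) • (a - b) ∈ K) →
    volume A * latticeCount n (polarBody n K) ≤ 6 ^ n * latticeCount n K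

lemma VolumeMulPolarBound.of_abs_coord_le_one {n : ℕ} (ih : VolumeMulPolarBound n)
    {K A : Set (Fin (n + 1) → ℝ)} (hK : Bornology.IsBounded K)
    (hK0 : (0 : Fin (n + 1) → ℝ) ∈ interior K) (hA : MeasurableSet A)
    (hAK : ∀ a ∈ A, ∀ b ∈ A, (1 / 2 : ℝ) • (a - b) ∈ K) (hcoord : ∀ x ∈ K, |x 0| ≤ 1) :
    volume A * latticeCount (n + 1) (polarBody (n + 1) K) ≤
      6 ^ (n + 1) * latticeCount (n + 1) K := by
  set K₀ : Set (Fin n → ℝ) := {x | (Fin.cons 0 x : Fin (n + 1) → ℝ) ∈ K}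
  obtain ⟨R, hR⟩ := hK.exists_norm_le
  obtain ⟨ε, hε, hεK⟩ := Metric.mem_nhds_iff.1 (mem_interior_iff_mem_nhds.1 hK0)
  have hK₀bd : Bornology.IsBounded K₀ := isBounded_iff_forall_norm_le.2 ⟨max R 0, fun x hx =>
    (pi_norm_le_iff_of_nonneg (le_max_right _ _)).2 fun i => le_max_of_le_left (by
      simpa using (norm_le_pi_norm (Fin.cons 0 x : Fin (n + 1) → ℝ) i.succ).trans (hR _ hx))⟩
  have hK₀0 : (0 : Fin n → ℝ) ∈ interior K₀ := by
    rw [mem_interior_iff_mem_nhds, Metric.mem_nhds_iff]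
    refine ⟨ε, hε, fun x hx => hεK ?_⟩
    rw [mem_ball_zero_iff, pi_norm_lt_iff hε] at hx ⊢
    refine Fin.cases (by simpa using hε) fun i => ?_
    simpa using hx i
  have hbdd : BddAbove ((fun x : Fin (n + 1) → ℝ => |x 0|) '' K) :=
    ⟨1, by rintro _ ⟨x, hx, rfl⟩; exact hcoord x hx⟩
  obtain ⟨l, hl0, hl1, hle, hlub⟩ : ∃ l : ℝ, 0 < l ∧ l ≤ 1 ∧ (∀ x ∈ K, |x 0| ≤ l) ∧
      ∀ c, (∀ x ∈ K, |x 0| ≤ c) → l ≤ c := by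
    have hne : K.Nonempty := ⟨0, interior_subset hK0⟩
    have hle : ∀ x ∈ K, |x 0| ≤ sSup ((fun x : Fin (n + 1) → ℝ => |x 0|) '' K) :=
      fun x hx => le_csSup hbdd ⟨x, hx, rfl⟩
    refine ⟨_, ?_, csSup_le (hne.image _) ?_, hle, fun c hc => csSup_le (hne.image _) ?_⟩
    · have hmem : Pi.single 0 (ε / 2) ∈ K := hεK (by
        rw [mem_ball_zero_iff, Pi.norm_single, Real.norm_of_nonneg (by positivity)]; linarith)
      refine lt_of_lt_of_le ?_ (hle _ hmem)
      simpa using hε.ne'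
    · rintro _ ⟨x, hx, rfl⟩; exact hcoord x hx
    · rintro _ ⟨x, hx, rfl⟩; exact hc x hx
  have hpol := latticeCount_polarBody_le (isBounded_polarBody hK0) (isBounded_polarBody hK₀0)
    (r := 2 / l) (by positivity) (fun a ha b hb hab => by
      by_contra! hlt
      have hpos : 0 < |a 0 - b 0| := lt_trans (by positivity) hlt
      have := hlub (2 / |a 0 - b 0|) fun x hx => by
        have h1 := half_sub_mem_polarBody ha hb x hx
        have htail (i : Fin n) : a i.succ = b i.succ := congrFun hab i
        simp only [Fin.sum_univ_succ, Pi.smul_apply, Pi.sub_apply, htail, sub_self, mul_zero,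
          zero_mul, Finset.sum_const_zero, add_zero, smul_eq_mul] at h1
        rw [abs_mul, abs_mul] at h1
        rw [abs_of_pos (by norm_num : (0 : ℝ) < 1 / 2)] at h1
        rw [le_div_iff₀ hpos]
        linarith
      rw [le_div_iff₀ hpos] at this
      rw [div_lt_iff₀ hl0] at hlt
      linarith)
  have hslice (t : ℝ) : volume {x : Fin n → ℝ | (Fin.cons t x : Fin (n + 1) → ℝ) ∈ A} *
      latticeCount n (polarBody n K₀) ≤ 6 ^ n * latticeCount n K₀ := by
    refine ih _ _ hK₀bd hK₀0 ?_ fun a ha b hb => ?_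
    · refine hA.preimage (measurable_pi_iff.2 (Fin.cases ?_ fun i => ?_))
      · simp
      · simpa using measurable_pi_apply i
    · have := hAK _ ha _ hb
      have e : (1 / 2 : ℝ) • ((Fin.cons t a : Fin (n + 1) → ℝ) - Fin.cons t b) =
          Fin.cons 0 ((1 / 2 : ℝ) • (a - b)) := by
        funext i
        refine Fin.cases ?_ (fun j => ?_) i <;> simp
      rwa [e] at this
  set T : Set ℝ := (fun x : Fin (n + 1) → ℝ => x 0) '' A
  have hT : volume T ≤ ENNReal.ofReal (2 * l) := by
    refine (Real.volume_le_diam T).trans (Metric.ediam_le ?_)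
    rintro _ ⟨a, ha, rfl⟩ _ ⟨b, hb, rfl⟩
    have := hle _ (hAK a ha b hb)
    simp only [Pi.smul_apply, Pi.sub_apply, smul_eq_mul, abs_mul] at this
    rw [abs_of_pos (by norm_num : (0 : ℝ) < 1 / 2)] at this
    rw [edist_dist, Real.dist_eq]
    exact ENNReal.ofReal_le_ofReal (by linarith)
  have hvol : volume A * latticeCount n (polarBody n K₀) ≤
      6 ^ n * latticeCount n K₀ * ENNReal.ofReal (2 * l) := by
    rw [volume_eq_lintegral_cons hA, ← lintegral_mul_const' _ _ (ENNReal.natCast_ne_top _)]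
    refine (lintegral_mono fun t => ?_).trans
      ((lintegral_indicator_const_le T _).trans (mul_le_mul_right hT _))
    by_cases ht : t ∈ T
    · rw [Set.indicator_of_mem ht]
      exact hslice t
    · have : {x : Fin n → ℝ | (Fin.cons t x : Fin (n + 1) → ℝ) ∈ A} = ∅ :=
        Set.eq_empty_of_forall_notMem fun x hx => ht ⟨_, hx, by simp⟩
      simp [this]
  have hmono : latticeCount n K₀ ≤ latticeCount (n + 1) K :=
    latticeCount_le_of_injective hK (fun x => Fin.cons 0 x)
      (Fin.cons_right_injective (α := fun _ => ℤ) 0)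
      fun x hx => by rw [cast_cons, Int.cast_zero]; exact hx
  have hk : ((⌊2 / l⌋₊ + 1 : ℕ) : ENNReal) * ENNReal.ofReal (2 * l) ≤ 6 := by
    rw [← ENNReal.ofReal_natCast, ← ENNReal.ofReal_mul (by positivity),
      ← ENNReal.ofReal_ofNat]
    refine ENNReal.ofReal_le_ofReal ?_
    have h1 := Nat.floor_le (show (0 : ℝ) ≤ 2 / l by positivity)
    have h2 : 2 / l * (2 * l) = 4 := by field_simp; norm_num
    push_cast
    nlinarith
  calc volume A * latticeCount (n + 1) (polarBody (n + 1) K)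
      ≤ volume A * (((⌊2 / l⌋₊ + 1 : ℕ) : ENNReal) * latticeCount n (polarBody n K₀)) := by
        gcongr
        exact_mod_cast hpol
    _ = volume A * latticeCount n (polarBody n K₀) * ((⌊2 / l⌋₊ + 1 : ℕ) : ENNReal) := by ring
    _ ≤ 6 ^ n * latticeCount n K₀ * ENNReal.ofReal (2 * l) * ((⌊2 / l⌋₊ + 1 : ℕ) : ENNReal) := by
        gcongr
    _ = 6 ^ n * latticeCount n K₀ *
        (((⌊2 / l⌋₊ + 1 : ℕ) : ENNReal) * ENNReal.ofReal (2 * l)) := by ring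
    _ ≤ 6 ^ n * latticeCount (n + 1) K * 6 := by gcongr
    _ = 6 ^ (n + 1) * latticeCount (n + 1) K := by ring

lemma exists_matrix_row_zero_smul_eq {n : ℕ} (z : Fin (n + 1) → ℤ) (hz : z ≠ 0) :
    ∃ U W : Matrix (Fin (n + 1)) (Fin (n + 1)) ℤ, U * W = 1 ∧ ∃ a : ℤ, a ≠ 0 ∧ z = a • W 0 := by
  obtain ⟨m, snf⟩ := Submodule.smithNormalForm (Pi.basisFun ℤ (Fin (n + 1)))
    (Submodule.span ℤ {z})
  have hzmem : z ∈ Submodule.span ℤ {z} := Submodule.mem_span_singleton_self z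
  have hm : m = 1 := by
    have h1 := Module.finrank_eq_card_basis snf.bN
    rw [← (LinearEquiv.toSpanNonzeroSingleton ℤ _ z hz).finrank_eq, Module.finrank_self,
      Fintype.card_fin] at h1
    exact h1.symm
  subst hm
  set b := snf.bM.reindex (Equiv.swap (snf.f 0) 0)
  have hb : b 0 = snf.bM (snf.f 0) := by simp [b]
  refine ⟨(b.toMatrix (Pi.basisFun ℤ (Fin (n + 1)))).transpose,
    ((Pi.basisFun ℤ (Fin (n + 1))).toMatrix b).transpose, ?_, ?_⟩
  · rw [← Matrix.transpose_mul, Module.Basis.toMatrix_mul_toMatrix_flip, Matrix.transpose_one]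
  · have hrow : ((Pi.basisFun ℤ (Fin (n + 1))).toMatrix b).transpose 0 = b 0 := by
      funext i
      simp [Matrix.transpose_apply, Module.Basis.toMatrix_apply]
    have hsum := congrArg Subtype.val (snf.bN.sum_repr ⟨z, hzmem⟩)
    simp only [Fin.sum_univ_one, Fin.isValue, Submodule.coe_smul] at hsum
    rw [snf.snf, smul_smul, ← hb] at hsum
    refine ⟨_, fun h0 => hz ?_, by rw [hrow]; exact hsum.symm⟩
    rw [← hsum, h0, zero_smul]

open scoped Pointwise in
lemma volume_mul_latticeCount_polarBody_le_of_trivial {n : ℕ} {K A : Set (Fin n → ℝ)}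
    (hK : Bornology.IsBounded K) (hA : MeasurableSet A)
    (hAK : ∀ a ∈ A, ∀ b ∈ A, (1 / 2 : ℝ) • (a - b) ∈ K)
    (htriv : ∀ z : Fin n → ℤ, (fun i => (z i : ℝ)) ∈ polarBody n K → z = 0) :
    volume A * latticeCount n (polarBody n K) ≤ 6 ^ n * latticeCount n K := by
  have h1 : latticeCount n (polarBody n K) ≤ 1 := by
    have : Subsingleton {z : Fin n → ℤ // (fun i => (z i : ℝ)) ∈ polarBody n K} :=
      ⟨fun x y => Subtype.ext ((htriv _ x.2).trans (htriv _ y.2).symm)⟩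
    exact Finite.card_le_one_iff_subsingleton.2 this
  have hvol : volume ((2 : ℝ)⁻¹ • A) ≤ latticeCount n K := by
    refine volume_le_latticeCount hK (hA.const_smul₀ _) ?_
    rintro _ ⟨a, ha, rfl⟩ _ ⟨b, hb, rfl⟩
    have := hAK a ha b hb
    rwa [smul_sub, one_div] at this
  have hA2 : volume A = 2 ^ n * volume ((2 : ℝ)⁻¹ • A) := by
    rw [Measure.addHaar_smul, ← mul_assoc, Module.finrank_fin_fun, abs_of_pos (by positivity),
      inv_pow, ENNReal.ofReal_inv_of_pos (by positivity), ENNReal.ofReal_pow (by norm_num),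
      ENNReal.ofReal_ofNat, ENNReal.mul_inv_cancel (by simp) (by simp), one_mul]
  calc volume A * latticeCount n (polarBody n K) ≤ volume A * 1 := by
        gcongr; exact_mod_cast h1
    _ = 2 ^ n * volume ((2 : ℝ)⁻¹ • A) := by rw [mul_one, hA2]
    _ ≤ 6 ^ n * latticeCount n K := by gcongr; norm_num

open scoped Matrix in
lemma VolumeMulPolarBound.of_matrix {n : ℕ} (ih : VolumeMulPolarBound n)
    {K A : Set (Fin (n + 1) → ℝ)} (hK : Bornology.IsBounded K)
    (hK0 : (0 : Fin (n + 1) → ℝ) ∈ interior K) (hA : MeasurableSet A)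
    (hAK : ∀ a ∈ A, ∀ b ∈ A, (1 / 2 : ℝ) • (a - b) ∈ K)
    {U W : Matrix (Fin (n + 1)) (Fin (n + 1)) ℤ} (hUW : U * W = 1)
    (hW : (fun i => (W 0 i : ℝ)) ∈ polarBody (n + 1) K) :
    volume A * latticeCount (n + 1) (polarBody (n + 1) K) ≤
      6 ^ (n + 1) * latticeCount (n + 1) K := by
  have hWU : W * U = 1 := mul_eq_one_comm.1 hUW
  set V : Matrix (Fin (n + 1)) (Fin (n + 1)) ℝ := U.map (Int.castRingHom ℝ) with hV
  set Y : Matrix (Fin (n + 1)) (Fin (n + 1)) ℝ := W.map (Int.castRingHom ℝ) with hY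
  have hYV : Y * V = 1 := by
    rw [hY, hV, ← Matrix.map_mul, hWU, Matrix.map_one _ (map_zero _) (map_one _)]
  have hYVx (x : Fin (n + 1) → ℝ) : Y *ᵥ (V *ᵥ x) = x := by
    rw [Matrix.mulVec_mulVec, hYV, Matrix.one_mulVec]
  have hVcont : Continuous fun x : Fin (n + 1) → ℝ => V *ᵥ x := by fun_prop
  have hcast (z : Fin (n + 1) → ℤ) :
      (fun i => ((U *ᵥ z) i : ℝ)) = V *ᵥ (fun i => (z i : ℝ)) := by
    funext i
    simp [hV, Matrix.mulVec, dotProduct]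
  have hcastT (z : Fin (n + 1) → ℤ) :
      (fun i => ((Uᵀ *ᵥ z) i : ℝ)) = Vᵀ *ᵥ (fun i => (z i : ℝ)) := by
    funext i
    simp [hV, Matrix.mulVec, dotProduct]
  set K' : Set (Fin (n + 1) → ℝ) := {x | V *ᵥ x ∈ K}
  set A' : Set (Fin (n + 1) → ℝ) := {x | V *ᵥ x ∈ A}
  have hK'bd : Bornology.IsBounded K' := by
    have hlip := (LinearMap.toContinuousLinearMap (Matrix.toLin' Y)).lipschitz
    refine (hlip.isBounded_image hK).subset fun x hx => ⟨_, hx, ?_⟩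
    simpa using hYVx x
  have hK'0 : (0 : Fin (n + 1) → ℝ) ∈ interior K' :=
    preimage_interior_subset_interior_preimage hVcont
      (by simpa [Matrix.mulVec_zero] using hK0)
  have hvol : volume A' = volume A := by
    have hdet : |V.det| = 1 := by
      have h1 : IsUnit U.det := (Matrix.isUnit_iff_isUnit_det U).1 (IsUnit.of_mul_eq_one _ hUW)
      have h2 : V.det = (U.det : ℝ) := by
        rw [hV]; exact ((Int.castRingHom ℝ).map_det U).symm
      rw [h2, ← Int.cast_abs, Int.isUnit_iff_abs_eq.1 h1, Int.cast_one]
    have h := Measure.addHaar_preimage_linearMap volume (f := Matrix.toLin' V)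
      (by rw [LinearMap.det_toLin']; intro h0; simp [h0] at hdet) A
    rw [LinearMap.det_toLin', abs_inv, hdet, inv_one, ENNReal.ofReal_one, one_mul] at h
    exact h
  have hcount : latticeCount (n + 1) K' ≤ latticeCount (n + 1) K :=
    latticeCount_le_of_injective hK (fun z => U *ᵥ z)
      (Function.LeftInverse.injective (g := fun z => W *ᵥ z) fun z => by
        simp [Matrix.mulVec_mulVec, hWU])
      fun z hz => by rw [hcast]; exact hz
  have hcountP : latticeCount (n + 1) (polarBody (n + 1) K) ≤
      latticeCount (n + 1) (polarBody (n + 1) K') := by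
    refine latticeCount_le_of_injective (isBounded_polarBody hK'0) (fun z => Uᵀ *ᵥ z)
      (Function.LeftInverse.injective (g := fun z => Wᵀ *ᵥ z) fun z => by
        simp [Matrix.mulVec_mulVec, ← Matrix.transpose_mul, hUW])
      fun z hz x hx => ?_
    have h := hz _ hx
    change |(fun i => (z i : ℝ)) ⬝ᵥ (V *ᵥ x)| ≤ 1 at h
    change |(fun i => ((Uᵀ *ᵥ z) i : ℝ)) ⬝ᵥ x| ≤ 1
    rwa [hcastT, Matrix.mulVec_transpose, ← Matrix.dotProduct_mulVec]
  have key := ih.of_abs_coord_le_one hK'bd hK'0 (A := A') (hA.preimage hVcont.measurable)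
    (fun a ha b hb => by
      have := hAK _ ha _ hb
      rwa [← Matrix.mulVec_sub, ← Matrix.mulVec_smul] at this)
    (fun x hx => by
      have h := hW _ hx
      change |(Y *ᵥ (V *ᵥ x)) 0| ≤ 1 at h
      rwa [hYVx] at h)
  rw [hvol] at key
  calc volume A * latticeCount (n + 1) (polarBody (n + 1) K)
      ≤ volume A * latticeCount (n + 1) (polarBody (n + 1) K') := by gcongr
    _ ≤ 6 ^ (n + 1) * latticeCount (n + 1) K' := key
    _ ≤ 6 ^ (n + 1) * latticeCount (n + 1) K := by gcongr

lemma volumeMulPolarBound (n : ℕ) : VolumeMulPolarBound n := by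
  induction n with
  | zero =>
    intro K A hK _ hA hAK
    exact volume_mul_latticeCount_polarBody_le_of_trivial hK hA hAK
      fun z _ => Subsingleton.elim _ _
  | succ n ih =>
    intro K A hK hK0 hA hAK
    by_cases htriv : ∀ z : Fin (n + 1) → ℤ, (fun i => (z i : ℝ)) ∈ polarBody (n + 1) K → z = 0
    · exact volume_mul_latticeCount_polarBody_le_of_trivial hK hA hAK htriv
    push Not at htriv
    obtain ⟨z, hzK, hz⟩ := htriv
    obtain ⟨U, W, hUW, a, ha, rfl⟩ := exists_matrix_row_zero_smul_eq z hz
    refine ih.of_matrix hK hK0 hA hAK hUW fun x hx => ?_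
    have h := hzK x hx
    have e : ∑ i, ((a • W 0) i : ℝ) * x i = a * ∑ i, (W 0 i : ℝ) * x i := by
      rw [Finset.mul_sum]
      exact Finset.sum_congr rfl fun i _ => by simp [mul_assoc]
    rw [e, abs_mul] at h
    have ha1 : (1 : ℝ) ≤ |(a : ℝ)| := by exact_mod_cast Int.one_le_abs ha
    exact (le_mul_of_one_le_left (abs_nonneg _) ha1).trans h

/-- For a bounded convex centrally symmetric body `K ⊆ ℝ^n` with `0` in its interior and
`0 < f ≤ V(K)·V(K*)`: `6^{-n} ≤ M(K)/(M(K*)·V(K)) ≤ 6^n/f`. -/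
theorem stmt7 (n : ℕ) (hn : 1 ≤ n) (K : Set (Fin n → ℝ))
    (hKbd : Bornology.IsBounded K) (hKconv : Convex ℝ K) (hKsymm : K = -K)
    (hK0 : (0 : Fin n → ℝ) ∈ interior K)
    (f : ℝ) (hf : 0 < f)
    (hfK : f ≤ (volume K).toReal * (volume (polarBody n K)).toReal) :
    (6 : ℝ) ^ (-(n : ℤ)) ≤
        (latticeCount n K : ℝ) /
          ((latticeCount n (polarBody n K) : ℝ) * (volume K).toReal) ∧
      (latticeCount n K : ℝ) /
          ((latticeCount n (polarBody n K) : ℝ) * (volume K).toReal) ≤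
        (6 : ℝ) ^ n / f := by
  have hPbd := isBounded_polarBody hK0
  have hP0 := zero_mem_interior_polarBody hKbd
  have hmid : ∀ a ∈ K, ∀ b ∈ K, (1 / 2 : ℝ) • (a - b) ∈ K := fun a ha b hb => by
    have hb' : -b ∈ K := by rw [hKsymm]; simpa using hb
    have := hKconv ha hb' (by norm_num : (0 : ℝ) ≤ 1 / 2) (by norm_num : (0 : ℝ) ≤ 1 / 2)
      (by norm_num)
    rwa [← smul_add, ← sub_eq_add_neg] at this
  have hint : volume (interior K) = volume K :=
    measure_interior_of_null_frontier (hKconv.addHaar_frontier volume)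
  have hlow := volumeMulPolarBound n K (interior K) hKbd hK0 measurableSet_interior
    fun a ha b hb => hmid a (interior_subset ha) b (interior_subset hb)
  have hup := volumeMulPolarBound n (polarBody n K) (polarBody n K) hPbd hP0
    (isClosed_polarBody K).measurableSet fun a ha b hb => half_sub_mem_polarBody ha hb
  have hbipolar : latticeCount n K ≤ latticeCount n (polarBody n (polarBody n K)) :=
    latticeCount_le_of_injective (isBounded_polarBody hP0) id Function.injective_id
      fun z hz y hy => by
        have := hy _ hz
        simp only [mul_comm] at this ⊢
        exact this
  rw [hint] at hlow
  have hlow' : (volume K).toReal * latticeCount n (polarBody n K) ≤ 6 ^ n * latticeCount n K := by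
    have := ENNReal.toReal_mono (by finiteness) hlow
    simpa using this
  have hup' : (volume (polarBody n K)).toReal * latticeCount n K ≤
      6 ^ n * latticeCount n (polarBody n K) := by
    have := ENNReal.toReal_mono (by finiteness) hup
    simp only [ENNReal.toReal_mul, ENNReal.toReal_natCast, ENNReal.toReal_pow,
      ENNReal.toReal_ofNat] at this
    refine le_trans ?_ this
    gcongr
  have hM : (0 : ℝ) < latticeCount n (polarBody n K) := by
    exact_mod_cast latticeCount_pos hPbd (zero_mem_polarBody K)
  have hV : 0 < (volume K).toReal :=
    pos_of_mul_pos_left (hf.trans_le hfK) ENNReal.toReal_nonneg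
  constructor
  · rw [zpow_neg, zpow_natCast, le_div_iff₀ (by positivity), inv_mul_le_iff₀ (by positivity)]
    linarith
  · rw [div_le_div_iff₀ (by positivity) hf]
    calc (latticeCount n K : ℝ) * f
        ≤ latticeCount n K * ((volume K).toReal * (volume (polarBody n K)).toReal) := by gcongr
      _ = (volume (polarBody n K)).toReal * latticeCount n K * (volume K).toReal := by ring
      _ ≤ 6 ^ n * latticeCount n (polarBody n K) * (volume K).toReal := by gcongr
      _ = 6 ^ n * (latticeCount n (polarBody n K) * (volume K).toReal) := by ring
end

section
/- Let V be a finite-dimensional real normed vector space with norm σ, and let W, P, Q be real vector spaces together with linear maps f : W → V and f' : P → Q injective, and g : V → Q and g' : W → P surjective, satisfying g ∘ f = f' ∘ g'. Then for every p ∈ P, inf{σ(f(w)) : w ∈ W, g'(w) = p} ≥ inf{σ(v) : v ∈ V, g(v) = f'(p)}. Moreover, if ker(g) ⊆ f(W), then equality holds for every p ∈ P. -/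
/-- For a commutative square with `f : W → V`, `f' : P → Q` injective and
`g : V → Q`, `g' : W → P` surjective, `g ∘ f = f' ∘ g'`, and `(V, ‖·‖)` a
finite-dimensional real normed space: the quotient norm on `P` of the subnorm on `W`
dominates the restriction to `P` of the quotient norm on `Q`, with equality when
`ker g ⊆ f(W)`. -/
theorem stmt10 (V W P Q : Type*) [NormedAddCommGroup V] [NormedSpace ℝ V]
    [FiniteDimensional ℝ V] [AddCommGroup W] [Module ℝ W]
    [AddCommGroup P] [Module ℝ P] [AddCommGroup Q] [Module ℝ Q]
    (f : W →ₗ[ℝ] V) (hf : Function.Injective f)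
    (f' : P →ₗ[ℝ] Q) (hf' : Function.Injective f')
    (g : V →ₗ[ℝ] Q) (hg : Function.Surjective g)
    (g' : W →ₗ[ℝ] P) (hg' : Function.Surjective g')
    (hcomm : g ∘ₗ f = f' ∘ₗ g') :
    (∀ p : P, sInf {r : ℝ | ∃ w : W, g' w = p ∧ r = ‖f w‖} ≥
        sInf {r : ℝ | ∃ v : V, g v = f' p ∧ r = ‖v‖}) ∧
      (LinearMap.ker g ≤ LinearMap.range f →
        ∀ p : P, sInf {r : ℝ | ∃ w : W, g' w = p ∧ r = ‖f w‖} =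
          sInf {r : ℝ | ∃ v : V, g v = f' p ∧ r = ‖v‖}) := by
  have hsq (w : W) : g (f w) = f' (g' w) := LinearMap.congr_fun hcomm w
  have hsub (p : P) : {r : ℝ | ∃ w : W, g' w = p ∧ r = ‖f w‖} ⊆
      {r : ℝ | ∃ v : V, g v = f' p ∧ r = ‖v‖} := by
    rintro r ⟨w, rfl, rfl⟩
    exact ⟨f w, hsq w, rfl⟩
  refine ⟨fun p => ?_, fun hker p => congrArg sInf ((hsub p).antisymm ?_)⟩
  · obtain ⟨w, hw⟩ := hg' p
    refine csInf_le_csInf ⟨0, ?_⟩ ⟨‖f w‖, w, hw, rfl⟩ (hsub p)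
    rintro r ⟨v, -, rfl⟩
    exact norm_nonneg v
  · rintro r ⟨v, hv, rfl⟩
    obtain ⟨w₀, rfl⟩ := hg' p
    obtain ⟨u, hu⟩ : v - f w₀ ∈ LinearMap.range f :=
      hker (by rw [LinearMap.mem_ker, map_sub, hv, hsq, sub_self])
    have hfw : f (u + w₀) = v := by rw [map_add, hu, sub_add_cancel]
    exact ⟨u + w₀, hf' (by rw [← hsq, hfw, hv]), by rw [hfw]⟩
end
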